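/- For every dimension d, every admissible differential operator L of type (α,β) with (α,β) ≠ (1,(0,…,0)), and every Pfaffian format (order r, degree (α₀,β₀)), there exists a finite constant C, depending only on d, L, and the format, with the following property: for every connected open set U ⊆ ℝ^d containing [0,1]^d, every Pfaffian function F on U of order r and degree (α₀,β₀), every closed set D ⊆ [0,1]^d, every c > 0 with |LF(x)| ≥ c for all x ∈ D, and every ε > 0, the Lebesgue measure of {x ∈ D : |F(x)| ≤ ε} is at most C · ε^{α/(|β|+1−α)} · c^{−1/(|β|+1−α)}. -/

import Mathlib

open MeasureTheory
open scoped ENNReal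

/-- The partial derivative `∂/∂x_i` of a scalar function on `ℝ^d`. -/
noncomputable def pderiv' {d : ℕ} (i : Fin d) (f : (Fin d → ℝ) → ℝ) : (Fin d → ℝ) → ℝ :=
  fun x => fderiv ℝ f x (Pi.single i 1)

/-- The classes `𝓛^{α,β}` of admissible differential operators of type `(α,β)`:
`𝓛^{1,0}` contains exactly the identity, and `L ∈ 𝓛^{α,β}` when there are distinct indices
`i_1,…,i_n` and operators `L_k ∈ 𝓛^{α_k,β_k}` with `α = Σ α_k`,
`β = Σ β_k + e_{i_1} + ⋯ + e_{i_n}` and `L F = det [∂_{x_{i_r}} (L_k F)]` for all smooth `F`. -/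
inductive IsAdmissible (d : ℕ) :
    ℕ → (Fin d → ℕ) → (((Fin d → ℝ) → ℝ) → (Fin d → ℝ) → ℝ) → Prop
  | id : IsAdmissible d 1 0 (fun F => F)
  | det (n : ℕ) (hn : 1 ≤ n) (hnd : n ≤ d) (i : Fin n → Fin d)
      (hi : Function.Injective i) (αs : Fin n → ℕ) (βs : Fin n → Fin d → ℕ)
      (Ls : Fin n → ((Fin d → ℝ) → ℝ) → (Fin d → ℝ) → ℝ)
      (hLs : ∀ k, IsAdmissible d (αs k) (βs k) (Ls k))
      (L : ((Fin d → ℝ) → ℝ) → (Fin d → ℝ) → ℝ)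
      (hL : ∀ F : (Fin d → ℝ) → ℝ, ∀ x, ContDiffAt ℝ (⊤ : ℕ∞) F x →
        L F x = (Matrix.of fun r k : Fin n => pderiv' (i r) (Ls k F) x).det) :
      IsAdmissible d (∑ k, αs k) ((∑ k, βs k) + ∑ k, Pi.single (i k) 1) L

/-- A Pfaffian chain of order `r` and degree `α₀` on `U ⊆ ℝ^d`. -/
def IsPfaffianChain {d : ℕ} (U : Set (Fin d → ℝ)) (r α₀ : ℕ)
    (f : Fin r → (Fin d → ℝ) → ℝ) : Prop :=
  (∀ j, AnalyticOnNhd ℝ (f j) U) ∧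
  ∀ j : Fin r, ∃ g : Fin d → MvPolynomial (Fin d ⊕ Fin (j + 1)) ℝ,
    (∀ i, (g i).totalDegree ≤ α₀) ∧
    ∀ x ∈ U, ∀ i,
      fderiv ℝ (f j) x (Pi.single i 1) =
        MvPolynomial.eval
          (Sum.elim x (fun k : Fin (j + 1) =>
            f ⟨k.1, by have := k.isLt; have := j.isLt; omega⟩ x)) (g i)

/-- A Pfaffian function of order `r` and degree `(α₀, β₀)` on `U ⊆ ℝ^d`;
its format is the data `(d, r, α₀, β₀)`. -/
def IsPfaffianFn {d : ℕ} (U : Set (Fin d → ℝ)) (r α₀ β₀ : ℕ)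
    (F : (Fin d → ℝ) → ℝ) : Prop :=
  ∃ f : Fin r → (Fin d → ℝ) → ℝ, IsPfaffianChain U r α₀ f ∧
    ∃ P : MvPolynomial (Fin d ⊕ Fin r) ℝ, P.totalDegree ≤ β₀ ∧
      ∀ x ∈ U, F x = MvPolynomial.eval (Sum.elim x (fun j => f j x)) P

section AreaFormula
open Set Function
open scoped NNReal

/-- The area inequality: a differentiable map on a measurable set whose fibres almost surely have
at most `N` points multiplies Lebesgue integrals by at most `N`. -/
theorem lintegral_abs_det_fderiv_mul_le_of_encard_fiber_le {n : ℕ} {s : Set (Fin n → ℝ)}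
    (hs : MeasurableSet s) {f : (Fin n → ℝ) → (Fin n → ℝ)}
    {f' : (Fin n → ℝ) → (Fin n → ℝ) →L[ℝ] (Fin n → ℝ)} (hf' : ∀ x, HasFDerivAt f (f' x) x)
    (hfm : Measurable fun x => (f' x).det) (N : ℕ)
    (hN : ∀ᵐ y, (f ⁻¹' {y}).encard ≤ N) (g : (Fin n → ℝ) → ℝ≥0∞) (hg : Measurable g) :
    ∫⁻ x in s, ENNReal.ofReal |(f' x).det| * g (f x) ≤ N * ∫⁻ y, g y := by
  set t : Set (Fin n → ℝ) := s ∩ {x | (f' x).det ≠ 0} with ht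
  have htm : MeasurableSet t := hs.inter (hfm (measurableSet_singleton 0).compl)
  have h1 : ∫⁻ x in s, ENNReal.ofReal |(f' x).det| * g (f x)
      ≤ ∫⁻ x in t, ENNReal.ofReal |(f' x).det| * g (f x) := by
    rw [← lintegral_indicator hs, ← lintegral_indicator htm]
    refine lintegral_mono fun x => ?_
    by_cases hx : x ∈ s
    · by_cases hd : (f' x).det = 0
      · simp [indicator, hd]
      · simp [indicator, hx, hd, ht]
    · simp [indicator, hx]
  refine h1.trans ?_
  have key : ∀ A : (Fin n → ℝ) →L[ℝ] (Fin n → ℝ), ∃ δ : ℝ≥0, δ ≠ 0 ∧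
      (A.det ≠ 0 → ∀ u, ApproximatesLinearOn f A u δ → InjOn f u) := by
    intro A
    by_cases hA : A.det = 0
    · exact ⟨1, one_ne_zero, fun h => absurd hA h⟩
    · let B := A.toContinuousLinearEquivOfDetNeZero hA
      have hB : (B : (Fin n → ℝ) →L[ℝ] (Fin n → ℝ)) = A := by
        ext; simp [B]
      rcases isEmpty_or_nonempty (Fin n) with hn | hn
      · refine ⟨1, one_ne_zero, fun _ u _ => ?_⟩
        exact fun x _ y _ _ => Subsingleton.elim x y
      · have hpos : 0 < ‖(B.symm : (Fin n → ℝ) →L[ℝ] (Fin n → ℝ))‖₊⁻¹ := by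
          have := B.subsingleton_or_nnnorm_symm_pos
          rcases this with h | h
          · exact absurd h (not_subsingleton _)
          · exact inv_pos.2 h
        refine ⟨_, (half_pos hpos).ne', fun _ u hu => ?_⟩
        rw [← hB] at hu
        exact hu.injOn (Or.inr (half_lt_self hpos))
  choose δ hδ0 hδ using key
  obtain ⟨w, A, wdisj, wmeas, wcov, wapp, wA⟩ :=
    exists_partition_approximatesLinearOn_of_hasFDerivWithinAt f t f'
      (fun x _ => (hf' x).hasFDerivWithinAt) δ hδ0
  have hinj : ∀ k, InjOn f (t ∩ w k) := by
    intro k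
    rcases t.eq_empty_or_nonempty with h | h
    · simp [h]
    · obtain ⟨y, hy, hyA⟩ := wA h k
      exact hδ _ (by rw [hyA]; exact hy.2) _ (wapp k)
  have hmk : ∀ k, MeasurableSet (t ∩ w k) := fun k => htm.inter (wmeas k)
  have himk : ∀ k, MeasurableSet (f '' (t ∩ w k)) := fun k =>
    measurable_image_of_fderivWithin (hmk k) (fun x _ => (hf' x).hasFDerivWithinAt) (hinj k)
  have hcov : t = ⋃ k, t ∩ w k := by
    rw [← inter_iUnion]; exact (inter_eq_left.2 wcov).symm
  calc ∫⁻ x in t, ENNReal.ofReal |(f' x).det| * g (f x)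
      = ∑' k, ∫⁻ x in t ∩ w k, ENNReal.ofReal |(f' x).det| * g (f x) := by
        conv_lhs => rw [hcov]
        rw [lintegral_iUnion hmk]
        exact fun i j hij => (wdisj hij).mono inter_subset_right inter_subset_right
    _ = ∑' k, ∫⁻ y, (f '' (t ∩ w k)).indicator g y := by
        congr 1; ext k
        rw [lintegral_indicator (himk k),
          lintegral_image_eq_lintegral_abs_det_fderiv_mul volume (hmk k)
            (fun x _ => (hf' x).hasFDerivWithinAt) (hinj k)]
    _ = ∫⁻ y, ∑' k, (f '' (t ∩ w k)).indicator g y := by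
        rw [lintegral_tsum fun k => (hg.indicator (himk k)).aemeasurable]
    _ ≤ ∫⁻ y, N * g y := by
        refine lintegral_mono_ae ?_
        filter_upwards [hN] with y hy
        refine ENNReal.summable.tsum_le_of_sum_le fun S => ?_
        classical
        have hS : ∑ k ∈ S, (f '' (t ∩ w k)).indicator g y
            = ((S.filter fun k => y ∈ f '' (t ∩ w k)).card : ℝ≥0∞) * g y := by
          simp only [indicator_apply]
          rw [← Finset.sum_filter, Finset.sum_const, nsmul_eq_mul]
        rw [hS]
        gcongr
        set S' := S.filter fun k => y ∈ f '' (t ∩ w k)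
        have hex : ∀ k ∈ S', ∃ x, x ∈ t ∩ w k ∧ f x = y := fun k hk => (Finset.mem_filter.1 hk).2
        choose! x hx using hex
        have hcard : (S' : Set ℕ).encard ≤ (f ⁻¹' {y}).encard := by
          refine encard_le_encard_of_injOn (f := x) (fun k hk => (hx k hk).2) ?_
          intro k hk l hl hkl
          by_contra hne
          exact (wdisj hne).le_bot ⟨(hx k hk).1.2, by rw [hkl]; exact (hx l hl).1.2⟩
        rw [encard_coe_eq_coe_finsetCard] at hcard
        exact_mod_cast hcard.trans hy
    _ = N * ∫⁻ y, g y := lintegral_const_mul _ hg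

end AreaFormula

section PolynomialFibres
open Set MvPolynomial

theorem volume_zeros_mvPolynomial_eq_zero {n : ℕ} {p : MvPolynomial (Fin n) ℝ} (hp : p ≠ 0) :
    volume {x : Fin n → ℝ | eval x p = 0} = 0 := by
  induction n with
  | zero =>
    have : {x : Fin 0 → ℝ | eval x p = 0} = ∅ := by
      ext x
      simp only [mem_ofPred_eq, mem_empty_iff_false, iff_false]
      intro h
      apply hp
      rw [MvPolynomial.eq_C_of_isEmpty p] at h ⊢
      rw [eval_C] at h
      rw [h, C_0]
    rw [this, measure_empty]
  | succ n ih =>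
    have hq : MvPolynomial.finSuccEquiv ℝ n p ≠ 0 := by
      simpa using hp
    set q := MvPolynomial.finSuccEquiv ℝ n p
    have hlc : q.leadingCoeff ≠ 0 := Polynomial.leadingCoeff_ne_zero.2 hq
    have hae := ih hlc
    have hmp := volume_preserving_piFinSuccAbove (fun _ : Fin (n + 1) => ℝ) 0
    have hcl : IsClosed {z : ℝ × (Fin n → ℝ) |
        eval (Fin.cons z.1 z.2 : Fin (n + 1) → ℝ) p = 0} := by
      refine isClosed_eq ?_ continuous_const
      refine (MvPolynomial.continuous_eval p).comp ?_
      refine continuous_pi fun i => ?_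
      refine Fin.cases ?_ (fun i => ?_) i
      · simpa using continuous_fst
      · exact (continuous_apply i).comp continuous_snd
    have hpre : {x : Fin (n + 1) → ℝ | eval x p = 0} =
        MeasurableEquiv.piFinSuccAbove (fun _ : Fin (n + 1) => ℝ) 0 ⁻¹'
          {z |
        eval (Fin.cons z.1 z.2 : Fin (n + 1) → ℝ) p = 0} := by
      ext x
      simp only [mem_ofPred_eq, mem_preimage]
      have : (Fin.cons (MeasurableEquiv.piFinSuccAbove (fun _ : Fin (n + 1) => ℝ) 0 x).1
          (MeasurableEquiv.piFinSuccAbove (fun _ : Fin (n + 1) => ℝ) 0 x).2 : Fin (n + 1) → ℝ)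
            = x := by
        ext i
        refine Fin.cases ?_ (fun i => ?_) i <;> simp [MeasurableEquiv.piFinSuccAbove, Fin.tail]
      rw [this]
    rw [hpre, hmp.measure_preimage_equiv, Measure.volume_eq_prod,
      Measure.prod_apply_symm hcl.measurableSet, lintegral_eq_zero_iff
        (measurable_measure_prodMk_right hcl.measurableSet)]
    have : ∀ᵐ s : Fin n → ℝ, eval s q.leadingCoeff ≠ 0 := by
      simpa [ae_iff] using hae
    filter_upwards [this] with s hs
    have hne : Polynomial.map (eval s) q ≠ 0 := by
      intro h
      apply hs
      have := congrArg (fun r => Polynomial.coeff r q.natDegree) h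
      simpa using this
    refine ((Polynomial.finite_setOfPred_isRoot hne).subset ?_).measure_zero _
    intro y hy
    simpa [Polynomial.IsRoot, eval_eq_eval_mv_eval'] using hy

theorem exists_mvPolynomial_relation_degreeOf_le (n D : ℕ) :
    ∃ M : ℕ, ∀ T : Fin (n + 1) → MvPolynomial (Fin n) ℝ, (∀ k, (T k).totalDegree ≤ D) →
      ∃ R : MvPolynomial (Fin (n + 1)) ℝ, R ≠ 0 ∧ degreeOf 0 R ≤ M ∧ aeval T R = 0 := by
  set M : ℕ := ((n + 1) * D + 1) ^ n + 1 with hM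
  refine ⟨M, fun T hT => ?_⟩
  set E : ℕ := (n + 1) * (M * D)
  let mon : (Fin (n + 1) → Fin M) → MvPolynomial (Fin n) ℝ := fun a => ∏ k, T k ^ (a k : ℕ)
  let Λ : ((Fin (n + 1) → Fin M) → ℝ) →ₗ[ℝ] ((Fin n → Fin (E + 1)) → ℝ) :=
    LinearMap.pi fun b => ∑ a, (LinearMap.proj a : ((Fin (n + 1) → Fin M) → ℝ) →ₗ[ℝ] ℝ).smulRight
      (coeff (Finsupp.equivFunOnFinite.symm fun i => (b i : ℕ)) (mon a))
  have hΛ : ∀ c b, Λ c b =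
      coeff (Finsupp.equivFunOnFinite.symm fun i => (b i : ℕ)) (∑ a, c a • mon a) := by
    intro c b
    simp [Λ, coeff_sum]
  have hrank : Module.finrank ℝ ((Fin n → Fin (E + 1)) → ℝ)
      < Module.finrank ℝ ((Fin (n + 1) → Fin M) → ℝ) := by
    simp only [Module.finrank_fintype_fun_eq_card, Fintype.card_fun, Fintype.card_fin]
    calc (E + 1) ^ n ≤ (M * ((n + 1) * D + 1)) ^ n := by
          gcongr
          have : 1 ≤ M := by omega
          calc E + 1 ≤ (n + 1) * (M * D) + M := by omega
            _ = M * ((n + 1) * D + 1) := by ring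
      _ = M ^ n * ((n + 1) * D + 1) ^ n := mul_pow _ _ _
      _ < M ^ n * M := by
          gcongr
          omega
      _ = M ^ (n + 1) := (pow_succ _ _).symm
  obtain ⟨c, hcker, hc0⟩ := (Submodule.ne_bot_iff _).1 (LinearMap.ker_ne_bot_of_finrank_lt hrank)
  have hdeg : ∀ a, (mon a).totalDegree ≤ E := by
    intro a
    refine (totalDegree_finsetProd _ _).trans ?_
    calc ∑ k, (T k ^ (a k : ℕ)).totalDegree ≤ ∑ _k : Fin (n + 1), M * D := by
          refine Finset.sum_le_sum fun k _ => (totalDegree_pow _ _).trans ?_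
          exact Nat.mul_le_mul (a k).2.le (hT k)
      _ = E := by simp [E]
  have hS : ∑ a, c a • mon a = 0 := by
    by_contra hne
    obtain ⟨b, hb⟩ := (MvPolynomial.ne_zero_iff).1 hne
    have hbE : ∀ i, b i ≤ E := by
      intro i
      refine (monomial_le_degreeOf i (mem_support_iff.2 hb)).trans
        ((degreeOf_le_totalDegree _ _).trans ?_)
      exact totalDegree_finsetSum_le fun a _ => (totalDegree_smul_le _ _).trans (hdeg a)
    have h0 := congrFun (LinearMap.mem_ker.1 hcker) (fun i => ⟨b i, by have := hbE i; omega⟩)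
    rw [hΛ, Pi.zero_apply] at h0
    apply hb
    convert h0 using 2
    ext i
    simp
  let e : (Fin (n + 1) → Fin M) → (Fin (n + 1) →₀ ℕ) :=
    fun a => Finsupp.equivFunOnFinite.symm fun i => (a i : ℕ)
  have he : Function.Injective e := by
    intro a b hab
    have := Finsupp.equivFunOnFinite.symm.injective hab
    funext i
    exact Fin.ext (congrFun this i)
  refine ⟨∑ a, monomial (e a) (c a), ?_, ?_, ?_⟩
  · intro h0
    apply hc0
    funext a
    have := congrArg (coeff (e a)) h0
    simpa [coeff_sum, coeff_monomial, he.eq_iff] using this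
  · rw [degreeOf_le_iff]
    intro m hm
    have := MvPolynomial.support_sum hm
    simp only [Finset.mem_biUnion] at this
    obtain ⟨a, -, ha⟩ := this
    have := support_monomial_subset ha
    rw [Finset.mem_singleton] at this
    rw [this]
    simp [e]
  · rw [map_sum, ← hS]
    refine Finset.sum_congr rfl fun a _ => ?_
    rw [aeval_monomial, Algebra.smul_def, Finsupp.prod_fintype _ _ (fun i => pow_zero _)]
    simp [mon, e]

/-- Generic fibres of a polynomial self-map of `ℝⁿ` have boundedly many points. -/
theorem exists_ae_encard_fiber_polynomial_le (n D : ℕ) :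
    ∃ N : ℕ, ∀ P : Fin n → MvPolynomial (Fin n) ℝ, (∀ k, (P k).totalDegree ≤ D) →
      ∀ᵐ y : Fin n → ℝ, ((fun x (i : Fin n) => eval x (P i)) ⁻¹' {y}).encard ≤ N := by
  obtain ⟨M, hM⟩ := exists_mvPolynomial_relation_degreeOf_le n (max 1 D)
  refine ⟨M ^ n, fun P hP => ?_⟩
  have hrel : ∀ j : Fin n, ∃ R : MvPolynomial (Fin (n + 1)) ℝ, R ≠ 0 ∧ degreeOf 0 R ≤ M ∧
      aeval (Fin.cons (X j) P : Fin (n + 1) → MvPolynomial (Fin n) ℝ) R = 0 := by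
    intro j
    refine hM _ fun k => ?_
    refine Fin.cases ?_ (fun k => ?_) k
    · simp
    · exact (hP k).trans (le_max_right _ _)
  choose R hR0 hRd hRe using hrel
  have hlc : ∀ j, (MvPolynomial.finSuccEquiv ℝ n (R j)).leadingCoeff ≠ 0 := fun j =>
    Polynomial.leadingCoeff_ne_zero.2 (by simpa using hR0 j)
  have hae : ∀ᵐ y : Fin n → ℝ, ∀ j,
      eval y (MvPolynomial.finSuccEquiv ℝ n (R j)).leadingCoeff ≠ 0 :=
    ae_all_iff.2 fun j => by
      simpa [ae_iff] using volume_zeros_mvPolynomial_eq_zero (hlc j)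
  filter_upwards [hae] with y hy
  classical
  let Z : Fin n → Finset ℝ := fun j =>
    (Polynomial.map (eval y) (MvPolynomial.finSuccEquiv ℝ n (R j))).roots.toFinset
  have hsub : ((fun x (i : Fin n) => eval x (P i)) ⁻¹' {y}) ⊆ (Fintype.piFinset Z : Set _) := by
    intro x hx
    have hx' : ∀ i, eval x (P i) = y i := fun i => congrFun hx i
    simp only [Finset.mem_coe, Fintype.mem_piFinset]
    intro j
    have hne : Polynomial.map (eval y) (MvPolynomial.finSuccEquiv ℝ n (R j)) ≠ 0 := by
      intro h
      apply hy j
      have := congrArg (fun r => Polynomial.coeff r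
        (MvPolynomial.finSuccEquiv ℝ n (R j)).natDegree) h
      simpa using this
    simp only [Z, Multiset.mem_toFinset, Polynomial.mem_roots hne, Polynomial.IsRoot]
    rw [← eval_eq_eval_mv_eval']
    have h0 : aeval x (aeval (Fin.cons (X j) P : Fin (n + 1) → MvPolynomial (Fin n) ℝ) (R j))
        = 0 := by
      rw [hRe j, map_zero]
    rw [← AlgHom.comp_apply, comp_aeval] at h0
    have harg : (fun i => aeval x ((Fin.cons (X j) P : Fin (n + 1) → MvPolynomial (Fin n) ℝ) i))
        = (Fin.cons (x j) y : Fin (n + 1) → ℝ) := by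
      funext i
      refine Fin.cases ?_ (fun i => ?_) i
      · simp
      · simpa [coe_aeval_eq_eval] using hx' i
    rw [← coe_aeval_eq_eval]
    rw [harg] at h0
    simpa [coe_aeval_eq_eval] using h0
  refine (encard_le_encard hsub).trans ?_
  rw [encard_coe_eq_coe_finsetCard, Fintype.card_piFinset]
  have : ∏ j, (Z j).card ≤ M ^ n := by
    calc ∏ j, (Z j).card ≤ ∏ _j : Fin n, M := by
          refine Finset.prod_le_prod' fun j _ => ?_
          refine (Multiset.toFinset_card_le _).trans ((Polynomial.card_roots' _).trans
            (Polynomial.natDegree_map_le.trans ?_))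
          rw [natDegree_finSuccEquiv]
          exact hRd j
      _ = M ^ n := by simp
  exact_mod_cast this

end PolynomialFibres

section JacobianDivergence
open Set

theorem ContDiff.pderiv' {d : ℕ} {f : (Fin d → ℝ) → ℝ} {m k : WithTop ℕ∞} (hf : ContDiff ℝ k f)
    (hmk : m + 1 ≤ k) (i : Fin d) : ContDiff ℝ m (pderiv' i f) :=
  (hf.fderiv_right hmk).clm_apply contDiff_const

/-- The Jacobian determinant with first row `w` and remaining rows the gradients of `G`. -/
noncomputable def crossDet {n : ℕ} (G : Fin n → (Fin (n + 1) → ℝ) → ℝ) (z w : Fin (n + 1) → ℝ) :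
    ℝ :=
  (Matrix.of (Fin.cons w fun i j => pderiv' j (G i) z) : Matrix (Fin (n + 1)) (Fin (n + 1)) ℝ).det

theorem crossDet_eq_sum_perm {n : ℕ} (G : Fin n → (Fin (n + 1) → ℝ) → ℝ) (z w : Fin (n + 1) → ℝ) :
    crossDet G z w = ∑ σ : Equiv.Perm (Fin (n + 1)),
      (Equiv.Perm.sign σ : ℝ) * (w (σ 0) * ∏ i, pderiv' (σ i.succ) (G i) z) := by
  rw [crossDet, ← Matrix.det_transpose, Matrix.det_apply']
  refine Finset.sum_congr rfl fun σ _ => ?_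
  rw [Fin.prod_univ_succ]
  simp

theorem crossDet_eq_sum {n : ℕ} (G : Fin n → (Fin (n + 1) → ℝ) → ℝ) (z w : Fin (n + 1) → ℝ) :
    crossDet G z w = ∑ j, w j * crossDet G z (Pi.single j 1) := by
  simp_rw [crossDet_eq_sum_perm, Finset.mul_sum]
  rw [Finset.sum_comm]
  refine Finset.sum_congr rfl fun σ _ => ?_
  rw [Finset.sum_eq_single (σ 0)]
  · simp; ring
  · intro b _ hb
    simp [hb.symm]
  · simp

theorem crossDet_add {n : ℕ} (G : Fin n → (Fin (n + 1) → ℝ) → ℝ) (z w w' : Fin (n + 1) → ℝ) :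
    crossDet G z (w + w') = crossDet G z w + crossDet G z w' := by
  rw [crossDet_eq_sum, crossDet_eq_sum G z w, crossDet_eq_sum G z w', ← Finset.sum_add_distrib]
  exact Finset.sum_congr rfl fun j _ => by rw [Pi.add_apply]; ring

theorem crossDet_smul {n : ℕ} (G : Fin n → (Fin (n + 1) → ℝ) → ℝ) (z w : Fin (n + 1) → ℝ) (a : ℝ) :
    crossDet G z (a • w) = a * crossDet G z w := by
  rw [crossDet_eq_sum, crossDet_eq_sum G z w, Finset.mul_sum]
  exact Finset.sum_congr rfl fun j _ => by rw [Pi.smul_apply, smul_eq_mul]; ring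

theorem crossDet_sum {n : ℕ} {ι : Type*} (s : Finset ι) (G : Fin n → (Fin (n + 1) → ℝ) → ℝ)
    (z : Fin (n + 1) → ℝ) (w : ι → Fin (n + 1) → ℝ) :
    crossDet G z (∑ i ∈ s, w i) = ∑ i ∈ s, crossDet G z (w i) := by
  classical
  induction s using Finset.induction_on with
  | empty => simpa using crossDet_smul G z 0 0
  | insert a s ha ih => rw [Finset.sum_insert ha, Finset.sum_insert ha, crossDet_add, ih]

theorem crossDet_gradient_eq_zero {n : ℕ} (G : Fin n → (Fin (n + 1) → ℝ) → ℝ)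
    (z : Fin (n + 1) → ℝ) (i : Fin n) : crossDet G z (fun j => pderiv' j (G i) z) = 0 := by
  rw [crossDet]
  refine Matrix.det_zero_of_row_eq (Fin.succ_ne_zero i).symm ?_
  funext j
  simp

theorem continuous_crossDet {n : ℕ} {G : Fin n → (Fin (n + 1) → ℝ) → ℝ}
    (hG : ∀ i, ContDiff ℝ 2 (G i)) {w : (Fin (n + 1) → ℝ) → Fin (n + 1) → ℝ} (hw : Continuous w) :
    Continuous fun z => crossDet G z (w z) := by
  simp_rw [crossDet_eq_sum_perm]
  refine continuous_finsetSum _ fun σ _ => continuous_const.mul (Continuous.mul ?_ ?_)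
  · exact (continuous_apply _).comp hw
  · exact continuous_finsetProd _ fun i _ =>
      ((hG i).pderiv' (m := 1) (by norm_num) _).continuous

theorem sum_sign_pderiv_prod_pderiv_eq_zero {n : ℕ} {G : Fin n → (Fin (n + 1) → ℝ) → ℝ}
    (hG : ∀ i, ContDiff ℝ 2 (G i)) (z : Fin (n + 1) → ℝ) :
    ∑ σ : Equiv.Perm (Fin (n + 1)), (Equiv.Perm.sign σ : ℝ) *
      pderiv' (σ 0) (fun z => ∏ i, pderiv' (σ i.succ) (G i) z) z = 0 := by
  have hd : ∀ i j, Differentiable ℝ (pderiv' j (G i)) := fun i j =>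
    ((hG i).pderiv' (m := 1) (by norm_num) _).differentiable (by norm_num)
  have hprod : ∀ σ : Equiv.Perm (Fin (n + 1)),
      pderiv' (σ 0) (fun z => ∏ i, pderiv' (σ i.succ) (G i) z) z
        = ∑ i, (∏ l ∈ Finset.univ.erase i, pderiv' (σ l.succ) (G l) z) *
            pderiv' (σ 0) (pderiv' (σ i.succ) (G i)) z := by
    intro σ
    have := HasFDerivAt.finsetProd (u := Finset.univ)
      (g := fun i : Fin n => pderiv' (σ i.succ) (G i)) (x := z)
      (fun i _ => (hd i (σ i.succ) z).hasFDerivAt)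
    conv_lhs => rw [pderiv']
    rw [this.fderiv]
    simp [pderiv']
  simp_rw [hprod, Finset.mul_sum]
  rw [Finset.sum_comm]
  refine Finset.sum_eq_zero fun i _ => ?_
  refine Finset.sum_involution (fun σ _ => σ * Equiv.swap 0 i.succ) ?_ ?_ ?_ ?_
  · intro σ _
    have h1 : ∀ l ∈ Finset.univ.erase i,
        (σ * Equiv.swap 0 i.succ) l.succ = σ l.succ := by
      intro l hl
      have : l.succ ≠ i.succ := fun h => (Finset.mem_erase.1 hl).1 (Fin.succ_injective _ h)
      rw [Equiv.Perm.mul_apply, Equiv.swap_apply_of_ne_of_ne (Fin.succ_ne_zero l) this]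
    have h2 : (∏ l ∈ Finset.univ.erase i, pderiv' ((σ * Equiv.swap 0 i.succ) l.succ) (G l) z)
        = ∏ l ∈ Finset.univ.erase i, pderiv' (σ l.succ) (G l) z :=
      Finset.prod_congr rfl fun l hl => by rw [h1 l hl]
    have hcomm : ∀ a b, pderiv' a (pderiv' b (G i)) z = pderiv' b (pderiv' a (G i)) z := by
      intro a b
      have hf : DifferentiableAt ℝ (fderiv ℝ (G i)) z :=
        ((hG i).fderiv_right (m := 1) (by norm_num)).differentiable (by norm_num) z
      have hx : ∀ a b, pderiv' a (pderiv' b (G i)) z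
          = fderiv ℝ (fderiv ℝ (G i)) z (Pi.single a 1) (Pi.single b 1) := by
        intro a b
        have : HasFDerivAt (pderiv' b (G i)) _ z :=
          hf.hasFDerivAt.clm_apply (hasFDerivAt_const (Pi.single b 1 : Fin (n + 1) → ℝ) z)
        rw [pderiv', this.fderiv]
        simp
      rw [hx, hx]
      exact ((hG i).contDiffAt.isSymmSndFDerivAt (by simp)) _ _
    rw [h2, Equiv.Perm.sign_mul, Equiv.Perm.sign_swap (Fin.succ_ne_zero i).symm]
    simp only [Equiv.Perm.mul_apply, Equiv.swap_apply_left, Equiv.swap_apply_right]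
    rw [hcomm (σ i.succ)]
    push_cast
    ring
  · intro σ _ _ h
    have : Equiv.swap 0 i.succ = 1 := by simpa using h
    exact (Fin.succ_ne_zero i).symm (Equiv.swap_eq_one_iff.1 this)
  · simp
  · intro σ _
    simp [mul_assoc]

/-- The Jacobian of `(ψ, G)` integrates to zero when `ψ` has compact support. -/
theorem integral_crossDet_gradient_eq_zero {n : ℕ} {G : Fin n → (Fin (n + 1) → ℝ) → ℝ}
    (hG : ∀ i, ContDiff ℝ 2 (G i)) {ψ : (Fin (n + 1) → ℝ) → ℝ} (hψ : ContDiff ℝ 1 ψ)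
    (hc : HasCompactSupport ψ) :
    ∫ z, crossDet G z (fun j => pderiv' j ψ z) = 0 := by
  have hP : ∀ σ : Equiv.Perm (Fin (n + 1)),
      ContDiff ℝ 1 (fun z => ∏ i, pderiv' (σ i.succ) (G i) z) := fun σ =>
    contDiff_prod fun i _ => (hG i).pderiv' (by norm_num) _
  have hcd : ∀ j, HasCompactSupport (pderiv' j ψ) := fun j => hc.fderiv_apply (𝕜 := ℝ) _
  have hψd : ∀ j, Continuous (pderiv' j ψ) := fun j =>
    (hψ.pderiv' (m := 0) (by norm_num) j).continuous
  have hPd : ∀ (σ : Equiv.Perm (Fin (n + 1))) j,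
      Continuous (pderiv' j (fun z => ∏ i, pderiv' (σ i.succ) (G i) z)) := fun σ j =>
    ((hP σ).pderiv' (m := 0) (by norm_num) j).continuous
  have hI1 : ∀ σ : Equiv.Perm (Fin (n + 1)),
      Integrable fun z => pderiv' (σ 0) ψ z * ∏ i, pderiv' (σ i.succ) (G i) z := fun σ =>
    ((hψd _).mul (hP σ).continuous).integrable_of_hasCompactSupport ((hcd _).mul_right)
  have hI2 : ∀ σ : Equiv.Perm (Fin (n + 1)),
      Integrable fun z => pderiv' (σ 0) (fun z => ∏ i, pderiv' (σ i.succ) (G i) z) z * ψ z :=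
    fun σ => ((hPd σ _).mul hψ.continuous).integrable_of_hasCompactSupport hc.mul_left
  have hI3 : ∀ σ : Equiv.Perm (Fin (n + 1)),
      Integrable fun z => (∏ i, pderiv' (σ i.succ) (G i) z) * ψ z :=
    fun σ => ((hP σ).continuous.mul hψ.continuous).integrable_of_hasCompactSupport hc.mul_left
  have hparts : ∀ σ : Equiv.Perm (Fin (n + 1)),
      ∫ z, pderiv' (σ 0) ψ z * ∏ i, pderiv' (σ i.succ) (G i) z
        = - ∫ z, pderiv' (σ 0) (fun z => ∏ i, pderiv' (σ i.succ) (G i) z) z * ψ z := by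
    intro σ
    refine Eq.trans ?_ (integral_mul_fderiv_eq_neg_fderiv_mul_of_integrable (hI2 σ) ?_ (hI3 σ)
      (fun x _ => (hP σ).differentiable (by norm_num) x)
      (fun x _ => hψ.differentiable (by norm_num) x))
    · exact integral_congr_ae (Filter.Eventually.of_forall fun z => mul_comm _ _)
    · exact (hI1 σ).congr (Filter.Eventually.of_forall fun z => mul_comm _ _)
  simp_rw [crossDet_eq_sum_perm]
  rw [integral_finsetSum _ fun σ _ => (hI1 σ).const_mul _]
  simp_rw [integral_const_mul, hparts, mul_neg, ← integral_const_mul]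
  rw [Finset.sum_neg_distrib, neg_eq_zero, ← integral_finsetSum _ fun σ _ => (hI2 σ).const_mul _]
  rw [← integral_zero (Fin (n + 1) → ℝ) ℝ]
  congr 1
  funext z
  simp_rw [← mul_assoc]
  rw [← Finset.sum_mul, sum_sign_pderiv_prod_pderiv_eq_zero hG z, zero_mul]

end JacobianDivergence

section Cutoffs
open Set
open scoped ContDiff

theorem exists_smooth_transition {a b : ℝ} (hab : a < b) :
    ∃ σ : ℝ → ℝ, ContDiff ℝ ∞ σ ∧ (∀ t ≤ a, σ t = 0) ∧ (∀ t, b ≤ t → σ t = 1) ∧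
      (∀ t, 0 ≤ σ t) ∧ (∀ t, σ t ≤ 1) ∧ (∀ t, 0 ≤ deriv σ t) ∧
      (∀ t ∉ Icc a b, deriv σ t = 0) ∧ ∫ t, deriv σ t = 1 := by
  have hba : 0 < b - a := sub_pos.2 hab
  let σ : ℝ → ℝ := fun t => Real.smoothTransition ((t - a) / (b - a))
  have hσ : ContDiff ℝ ∞ σ :=
    Real.smoothTransition.contDiff.comp ((contDiff_id.sub contDiff_const).div_const _)
  have h0 : ∀ t ≤ a, σ t = 0 := fun t ht =>
    Real.smoothTransition.zero_of_nonpos (div_nonpos_of_nonpos_of_nonneg (by linarith) hba.le)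
  have h1 : ∀ t, b ≤ t → σ t = 1 := fun t ht =>
    Real.smoothTransition.one_of_one_le ((one_le_div hba).2 (by linarith))
  have hmono : Monotone σ := fun s t hst =>
    Real.smoothTransition.monotone (div_le_div_of_nonneg_right (by linarith) hba.le)
  have hsupp : ∀ t ∉ Icc a b, deriv σ t = 0 := by
    intro t ht
    rw [mem_Icc, not_and_or, not_le, not_le] at ht
    rcases ht with ht | ht
    · have : σ =ᶠ[nhds t] fun _ => 0 := by
        filter_upwards [Iio_mem_nhds ht] with s hs using h0 s (le_of_lt hs)
      rw [this.deriv_eq, deriv_const]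
    · have : σ =ᶠ[nhds t] fun _ => 1 := by
        filter_upwards [Ioi_mem_nhds ht] with s hs using h1 s (le_of_lt hs)
      rw [this.deriv_eq, deriv_const]
  refine ⟨σ, hσ, h0, h1, fun t => Real.smoothTransition.nonneg _,
    fun t => Real.smoothTransition.le_one _, fun t => hmono.deriv_nonneg, hsupp, ?_⟩
  rw [← setIntegral_eq_integral_of_forall_compl_eq_zero hsupp, integral_Icc_eq_integral_Ioc,
    ← intervalIntegral.integral_of_le hab.le, intervalIntegral.integral_deriv_eq_sub]
  · rw [h0 a le_rfl, h1 b le_rfl, sub_zero]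
  · exact fun t _ => hσ.differentiable (by simp) t
  · exact (hσ.continuous_deriv (by simp)).intervalIntegrable _ _

/-- A smooth nonnegative compactly supported function of integral one. -/
structure IsUnitBump (s : ℝ → ℝ) : Prop where
  contDiff : ContDiff ℝ ∞ s
  hasCompactSupport : HasCompactSupport s
  nonneg : ∀ t, 0 ≤ s t
  integral_eq : ∫ t, s t = 1

theorem exists_smooth_transition_isUnitBump {a b : ℝ} (hab : a < b) :
    ∃ σ : ℝ → ℝ, ContDiff ℝ ∞ σ ∧ (∀ t ≤ a, σ t = 0) ∧ (∀ t, b ≤ t → σ t = 1) ∧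
      (∀ t, 0 ≤ σ t) ∧ (∀ t, σ t ≤ 1) ∧ (∀ t ∉ Icc a b, deriv σ t = 0) ∧
      IsUnitBump (deriv σ) := by
  obtain ⟨σ, h1, h2, h3, h4, h5, h6, h7, h8⟩ := exists_smooth_transition hab
  refine ⟨σ, h1, h2, h3, h4, h5, h7, ⟨?_, ?_, h6, h8⟩⟩
  · exact (contDiff_infty_iff_deriv.1 h1).2
  · exact HasCompactSupport.intro isCompact_Icc h7

theorem exists_smooth_cutoff {a a' b' b : ℝ} (h1 : a < a') (h2 : b' < b) :
    ∃ ψ s₁ s₂ : ℝ → ℝ, ContDiff ℝ ∞ ψ ∧ IsUnitBump s₁ ∧ IsUnitBump s₂ ∧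
      (∀ t ∉ Icc a b, ψ t = 0) ∧ (∀ t ∈ Icc a' b', ψ t = 1) ∧ (∀ t, 0 ≤ ψ t) ∧ (∀ t, ψ t ≤ 1) ∧
      (∀ t, |deriv ψ t| ≤ s₁ t + s₂ t) := by
  obtain ⟨σ, c1, z1, o1, n1, l1, -, u1⟩ := exists_smooth_transition_isUnitBump h1
  obtain ⟨τ, c2, z2, o2, n2, l2, -, u2⟩ := exists_smooth_transition_isUnitBump h2
  refine ⟨fun t => σ t * (1 - τ t), deriv σ, deriv τ, c1.mul (contDiff_const.sub c2), u1, u2,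
    ?_, ?_, fun t => mul_nonneg (n1 t) (sub_nonneg.2 (l2 t)), ?_, ?_⟩
  · intro t ht
    rw [mem_Icc, not_and_or, not_le, not_le] at ht
    rcases ht with ht | ht
    · simp [z1 t ht.le]
    · simp [o2 t ht.le]
  · intro t ht
    simp [o1 t ht.1, z2 t ht.2]
  · intro t
    exact mul_le_one₀ (l1 t) (sub_nonneg.2 (l2 t)) (by linarith [n2 t])
  · intro t
    have hd : HasDerivAt (fun t => σ t * (1 - τ t))
        (deriv σ t * (1 - τ t) + σ t * (-deriv τ t)) t :=
      (c1.differentiable (by simp) t).hasDerivAt.mul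
        ((c2.differentiable (by simp) t).hasDerivAt.const_sub 1)
    rw [hd.deriv]
    have p1 := u1.nonneg t
    have p2 := u2.nonneg t
    rw [abs_le]
    constructor <;> nlinarith [mul_nonneg p1 (n2 t), mul_nonneg p1 (sub_nonneg.2 (l2 t)),
      mul_nonneg p2 (n1 t), mul_nonneg p2 (sub_nonneg.2 (l1 t))]

theorem abs_integral_le_of_setLIntegral_le {E : Type*} [MeasurableSpace E] {μ : Measure E}
    {F g : E → ℝ} {B : Set E} (hB : MeasurableSet B) {c M : ℝ} (hc : 0 ≤ c) (hM : 0 ≤ M)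
    (h1 : ∀ z ∈ B, |F z| ≤ c * g z) (h2 : ∀ z ∉ B, F z = 0)
    (h3 : ∫⁻ z in B, ENNReal.ofReal (g z) ∂μ ≤ ENNReal.ofReal M) : |∫ z, F z ∂μ| ≤ c * M := by
  rw [← ENNReal.ofReal_le_ofReal_iff (mul_nonneg hc hM), ← Real.norm_eq_abs, ofReal_norm]
  calc ‖∫ z, F z ∂μ‖ₑ ≤ ∫⁻ z, ‖F z‖ₑ ∂μ := enorm_integral_le_lintegral_enorm _
    _ ≤ ∫⁻ z in B, ENNReal.ofReal c * ENNReal.ofReal (g z) ∂μ := by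
        rw [← lintegral_indicator hB]
        refine lintegral_mono fun z => ?_
        by_cases hz : z ∈ B
        · rw [indicator_of_mem hz, ← ENNReal.ofReal_mul hc, ← ofReal_norm, Real.norm_eq_abs]
          exact ENNReal.ofReal_le_ofReal (h1 z hz)
        · simp [h2 z hz]
    _ = ENNReal.ofReal c * ∫⁻ z in B, ENNReal.ofReal (g z) ∂μ :=
        lintegral_const_mul' _ _ ENNReal.ofReal_ne_top
    _ ≤ ENNReal.ofReal (c * M) := by
        rw [ENNReal.ofReal_mul hc]
        gcongr

theorem integral_fin_succ_eq {n : ℕ} (F : (Fin (n + 1) → ℝ) → ℝ) (hF : Continuous F)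
    (hc : HasCompactSupport F) :
    ∫ z, F z = ∫ x : Fin n → ℝ, ∫ y : ℝ, F (Fin.cons y x) := by
  have hmp := (volume_preserving_piFinSuccAbove (fun _ : Fin (n + 1) => ℝ) 0).symm
  rw [← hmp.integral_comp' F, Measure.volume_eq_prod, integral_prod_symm]
  · simp [MeasurableEquiv.piFinSuccAbove, Fin.consEquiv]
  · rw [← Measure.volume_eq_prod]
    exact (hmp.integrable_comp_emb (MeasurableEquiv.measurableEmbedding _)).2
      (hF.integrable_of_hasCompactSupport hc)

theorem lintegral_fin_succ_mul {n : ℕ} {a : ℝ → ℝ≥0∞} {b : (Fin n → ℝ) → ℝ≥0∞}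
    (ha : Measurable a) (hb : Measurable b) :
    ∫⁻ z : Fin (n + 1) → ℝ, a (z 0) * b (Fin.tail z) = (∫⁻ y, a y) * ∫⁻ x, b x := by
  have hmp := (volume_preserving_piFinSuccAbove (fun _ : Fin (n + 1) => ℝ) 0).symm
  rw [← hmp.lintegral_comp_emb (MeasurableEquiv.measurableEmbedding _), Measure.volume_eq_prod,
    ← lintegral_prod_mul ha.aemeasurable hb.aemeasurable]
  simp [MeasurableEquiv.piFinSuccAbove, Fin.consEquiv]

end Cutoffs

section RolleStep
open Set
open scoped ContDiff

/-- Integrated Rolle inequality: with `∇h` and `∇Q` the gradients, the integral of the Jacobian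
`(h, G)` weighted by `H'(h)` and a smoothed sign `S(Q)` is bounded through the Jacobians `(Q, G)`
and `(z_k, G)`. -/
theorem abs_integral_crossDet_le {n : ℕ} {G : Fin n → (Fin (n + 1) → ℝ) → ℝ}
    (hG : ∀ i, ContDiff ℝ ∞ (G i)) {Q h : (Fin (n + 1) → ℝ) → ℝ} (hQ : ContDiff ℝ ∞ Q)
    (hh : ContDiff ℝ ∞ h) {φ : (Fin n → ℝ) → ℝ} (hφ : ContDiff ℝ 1 φ) (hφ0 : ∀ p, 0 ≤ φ p)
    {A B : Fin (n + 1) → ℝ} {M : ℝ} (hM : 0 ≤ M)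
    (hMQ : ∀ s, IsUnitBump s → ∫⁻ z in Icc A B, ENNReal.ofReal
      (s (Q z) * φ (fun i => G i z) * |crossDet G z fun j => pderiv' j Q z|) ≤ ENNReal.ofReal M)
    (hMk : ∀ k, ∀ s, IsUnitBump s → ∫⁻ z in Icc A B, ENNReal.ofReal
      (s (z k) * φ (fun i => G i z) * |crossDet G z (Pi.single k 1)|) ≤ ENNReal.ofReal M)
    {H : ℝ → ℝ} (hH : ContDiff ℝ ∞ H) (hH0 : ∀ t, 0 ≤ H t) (hH1 : ∀ t, H t ≤ 1)
    {σ : ℝ → ℝ} (hσ : ContDiff ℝ ∞ σ) (hσ0 : ∀ t, 0 ≤ σ t) (hσ1 : ∀ t, σ t ≤ 1)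
    (hσb : IsUnitBump (deriv σ))
    {ψ s₁ s₂ : Fin (n + 1) → ℝ → ℝ} (hψ : ∀ k, ContDiff ℝ ∞ (ψ k))
    (hs₁ : ∀ k, IsUnitBump (s₁ k)) (hs₂ : ∀ k, IsUnitBump (s₂ k))
    (hψz : ∀ k, ∀ t ∉ Icc (A k) (B k), ψ k t = 0) (hψ0 : ∀ k t, 0 ≤ ψ k t)
    (hψ1 : ∀ k t, ψ k t ≤ 1) (hψd : ∀ k t, |deriv (ψ k) t| ≤ s₁ k t + s₂ k t) :
    |∫ z, deriv H (h z) * (φ (fun i => G i z) * crossDet G z (fun j => pderiv' j h z) *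
      (2 * σ (Q z) - 1) * ∏ k, ψ k (z k))| ≤ (2 + 2 * (n + 1)) * M := by
  have hG2 : ∀ i, ContDiff ℝ 2 (G i) := fun i => (hG i).of_le (by norm_cast)
  have hGd : ∀ i, Differentiable ℝ (G i) := fun i => (hG i).differentiable (by simp)
  have hQd : Differentiable ℝ Q := hQ.differentiable (by simp)
  have hhd : Differentiable ℝ h := hh.differentiable (by simp)
  have hφG : ContDiff ℝ 1 fun z => φ fun i => G i z :=
    hφ.comp (contDiff_pi.2 fun i => (hG i).of_le (by exact_mod_cast le_top))
  have hψm : ∀ k, ContDiff ℝ 1 fun z : Fin (n + 1) → ℝ => ψ k (z k) := fun k =>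
    ((hψ k).of_le (by exact_mod_cast le_top)).comp (contDiff_apply ℝ ℝ k)
  have hχ : ContDiff ℝ 1 fun z : Fin (n + 1) → ℝ => ∏ k, ψ k (z k) :=
    contDiff_prod fun k _ => hψm k
  have hHh : ContDiff ℝ 1 fun z => H (h z) := (hH.comp hh).of_le (by exact_mod_cast le_top)
  have hSQ : ContDiff ℝ 1 fun z => 2 * σ (Q z) - 1 :=
    ((contDiff_const.mul (hσ.comp hQ)).sub contDiff_const).of_le (by exact_mod_cast le_top)
  have hχz : ∀ z ∉ Icc A B, ∏ k, ψ k (z k) = 0 := by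
    intro z hz
    rw [← pi_univ_Icc, mem_univ_pi] at hz
    push Not at hz
    obtain ⟨k, hk⟩ := hz
    exact Finset.prod_eq_zero (Finset.mem_univ k) (hψz k _ hk)
  have hχ0 : ∀ z : Fin (n + 1) → ℝ, 0 ≤ ∏ k, ψ k (z k) := fun z =>
    Finset.prod_nonneg fun k _ => hψ0 k _
  have hχ1 : ∀ z : Fin (n + 1) → ℝ, ∏ k, ψ k (z k) ≤ 1 := fun z =>
    Finset.prod_le_one (fun k _ => hψ0 k _) fun k _ => hψ1 k _
  have hχe : ∀ (z : Fin (n + 1) → ℝ) k, |∏ l ∈ Finset.univ.erase k, ψ l (z l)| ≤ 1 := by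
    intro z k
    rw [abs_of_nonneg (Finset.prod_nonneg fun l _ => hψ0 l _)]
    exact Finset.prod_le_one (fun l _ => hψ0 l _) fun l _ => hψ1 l _
  have hψz' : ∀ k, ∀ t ∉ Icc (A k) (B k), deriv (ψ k) t = 0 := by
    intro k t ht
    have : ψ k =ᶠ[nhds t] fun _ => 0 := by
      filter_upwards [isClosed_Icc.isOpen_compl.mem_nhds ht] with s hs using hψz k s hs
    rw [this.deriv_eq, deriv_const]
  have hS1 : ∀ q, |2 * σ q - 1| ≤ 1 := fun q => by
    rw [abs_le]; constructor <;> linarith [hσ0 q, hσ1 q]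
  have hHa : ∀ q, |H q| ≤ 1 := fun q => by rw [abs_of_nonneg (hH0 q)]; exact hH1 q
  let Φ : (Fin (n + 1) → ℝ) → ℝ := fun z => φ fun i => G i z
  let χ : (Fin (n + 1) → ℝ) → ℝ := fun z => ∏ k, ψ k (z k)
  let T₁ : (Fin (n + 1) → ℝ) → ℝ := fun z => deriv H (h z) *
    (Φ z * crossDet G z (fun j => pderiv' j h z) * (2 * σ (Q z) - 1) * χ z)
  let T₂ : (Fin (n + 1) → ℝ) → ℝ := fun z => 2 * deriv σ (Q z) *
    (Φ z * H (h z) * χ z) * crossDet G z (fun j => pderiv' j Q z)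
  let T₃ : Fin (n + 1) → (Fin (n + 1) → ℝ) → ℝ := fun k z =>
    (Φ z * H (h z) * (2 * σ (Q z) - 1)) *
      ((deriv (ψ k) (z k) * ∏ l ∈ Finset.univ.erase k, ψ l (z l)) *
        crossDet G z (Pi.single k 1))
  have hpt : ∀ z, crossDet G z (fun j => pderiv' j
      (fun z => Φ z * H (h z) * (2 * σ (Q z) - 1) * χ z) z) = T₁ z + T₂ z + ∑ k, T₃ k z := by
    intro z
    have d1 : HasFDerivAt Φ (∑ i, fderiv ℝ φ (fun i => G i z) (Pi.single i 1) •
        fderiv ℝ (G i) z) z := by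
      have e1 := (hφ.differentiable (by norm_num) fun i => G i z).hasFDerivAt.comp z
        (hasFDerivAt_pi.2 fun i => (hGd i z).hasFDerivAt)
      refine e1.congr_fderiv (ContinuousLinearMap.ext fun w => ?_)
      rw [sum_apply, ContinuousLinearMap.comp_apply]
      conv_lhs => rw [pi_eq_sum_univ' ((ContinuousLinearMap.pi fun i => fderiv ℝ (G i) z) w)]
      rw [map_sum]
      refine Finset.sum_congr rfl fun i _ => ?_
      rw [map_smul, smul_apply, smul_eq_mul, smul_eq_mul, ContinuousLinearMap.pi_apply, mul_comm]
    have d2 : HasFDerivAt (fun z => H (h z)) (deriv H (h z) • fderiv ℝ h z) z :=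
      (hH.differentiable (by simp) (h z)).hasDerivAt.comp_hasFDerivAt z (hhd z).hasFDerivAt
    have d3 : HasFDerivAt (fun z => 2 * σ (Q z) - 1)
        ((2 : ℝ) • (deriv σ (Q z) • fderiv ℝ Q z)) z :=
      (((hσ.differentiable (by simp) (Q z)).hasDerivAt.comp_hasFDerivAt z
        (hQd z).hasFDerivAt).const_mul 2).sub_const 1
    have d4 : HasFDerivAt χ (∑ k, (∏ l ∈ Finset.univ.erase k, ψ l (z l)) •
        (deriv (ψ k) (z k) • ContinuousLinearMap.proj (R := ℝ) (φ := fun _ => ℝ) k)) z :=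
      HasFDerivAt.finsetProd (u := Finset.univ) (g := fun k (z : Fin (n + 1) → ℝ) => ψ k (z k))
        fun k _ => ((hψ k).differentiable (by simp) (z k)).hasDerivAt.comp_hasFDerivAt z
          (hasFDerivAt_apply k z)
    have hgrad : (fun j => pderiv' j (fun z => Φ z * H (h z) * (2 * σ (Q z) - 1) * χ z) z)
        = (∑ i, (H (h z) * (2 * σ (Q z) - 1) * χ z *
              fderiv ℝ φ (fun i => G i z) (Pi.single i 1)) • (fun j => pderiv' j (G i) z))
          + (deriv H (h z) * (Φ z * (2 * σ (Q z) - 1) * χ z)) • (fun j => pderiv' j h z)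
          + (2 * deriv σ (Q z) * (Φ z * H (h z) * χ z)) • (fun j => pderiv' j Q z)
          + ∑ k, (Φ z * H (h z) * (2 * σ (Q z) - 1) *
              (deriv (ψ k) (z k) * ∏ l ∈ Finset.univ.erase k, ψ l (z l))) •
              (Pi.single k 1 : Fin (n + 1) → ℝ) := by
      funext j
      have dd : HasFDerivAt (fun z => Φ z * H (h z) * (2 * σ (Q z) - 1) * χ z) _ z :=
        ((d1.mul d2).mul d3).mul d4
      rw [pderiv', dd.fderiv]
      have e1 : ∀ k, (Pi.single j (1 : ℝ) : Fin (n + 1) → ℝ) k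
          = (Pi.single k (1 : ℝ) : Fin (n + 1) → ℝ) j := by
        intro k; simp [Pi.single_apply, eq_comm]
      simp only [add_apply, smul_apply, smul_eq_mul, sum_apply, ContinuousLinearMap.proj_apply,
        Pi.add_apply, Finset.sum_apply, Pi.smul_apply, Pi.mul_apply, pderiv', e1]
      have e2 : ∑ i, H (h z) * (2 * σ (Q z) - 1) * χ z *
            fderiv ℝ φ (fun i => G i z) (Pi.single i 1) * fderiv ℝ (G i) z (Pi.single j 1) =
          H (h z) * (2 * σ (Q z) - 1) * χ z * ∑ i,
            fderiv ℝ φ (fun i => G i z) (Pi.single i 1) * fderiv ℝ (G i) z (Pi.single j 1) := by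
        rw [Finset.mul_sum]
        exact Finset.sum_congr rfl fun i _ => by ring
      have e3 : ∑ k, Φ z * H (h z) * (2 * σ (Q z) - 1) *
            (deriv (ψ k) (z k) * ∏ l ∈ Finset.univ.erase k, ψ l (z l)) *
              (Pi.single k (1 : ℝ) : Fin (n + 1) → ℝ) j =
          Φ z * H (h z) * (2 * σ (Q z) - 1) * ∑ k, (∏ l ∈ Finset.univ.erase k, ψ l (z l)) *
            (deriv (ψ k) (z k) * (Pi.single k (1 : ℝ) : Fin (n + 1) → ℝ) j) := by
        rw [Finset.mul_sum]
        exact Finset.sum_congr rfl fun i _ => by ring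
      rw [e2, e3]
      ring
    rw [hgrad, crossDet_add, crossDet_add, crossDet_add, crossDet_sum, crossDet_sum]
    simp only [crossDet_smul, crossDet_gradient_eq_zero, mul_zero, Finset.sum_const_zero, zero_add]
    congr 1
    · simp only [T₁, T₂]; ring
    · refine Finset.sum_congr rfl fun k _ => ?_
      simp only [T₃]; ring
  have h_int : ∀ F : (Fin (n + 1) → ℝ) → ℝ, Continuous F → (∀ z ∉ Icc A B, F z = 0) →
      Integrable F := fun F hF h0 =>
    hF.integrable_of_hasCompactSupport (HasCompactSupport.intro isCompact_Icc h0)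
  have cΦ : Continuous Φ := hφG.continuous
  have cχ : Continuous χ := hχ.continuous
  have cH' : Continuous fun z => deriv H (h z) :=
    (contDiff_infty_iff_deriv.1 hH).2.continuous.comp hh.continuous
  have cσ' : Continuous fun z => deriv σ (Q z) := hσb.contDiff.continuous.comp hQ.continuous
  have cdh : Continuous fun z => crossDet G z (fun j => pderiv' j h z) :=
    continuous_crossDet hG2 (continuous_pi fun j =>
      (hh.pderiv' (m := 1) (by norm_cast) j).continuous)
  have cdQ : Continuous fun z => crossDet G z (fun j => pderiv' j Q z) :=
    continuous_crossDet hG2 (continuous_pi fun j =>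
      (hQ.pderiv' (m := 1) (by norm_cast) j).continuous)
  have cdk : ∀ k, Continuous fun z => crossDet G z (Pi.single k 1) := fun k =>
    continuous_crossDet hG2 continuous_const
  have i₁ : Integrable T₁ := by
    refine h_int _ (cH'.mul (((cΦ.mul cdh).mul hSQ.continuous).mul cχ)) fun z hz => ?_
    simp only [T₁, χ, hχz z hz, mul_zero]
  have i₂ : Integrable T₂ := by
    refine h_int _ (((continuous_const.mul cσ').mul ((cΦ.mul hHh.continuous).mul cχ)).mul cdQ)
      fun z hz => ?_
    simp only [T₂, χ, hχz z hz, mul_zero, zero_mul]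
  have z₃ : ∀ k, ∀ z ∉ Icc A B, T₃ k z = 0 := by
    intro k z hz
    rw [← pi_univ_Icc, mem_univ_pi] at hz
    push Not at hz
    obtain ⟨l, hl⟩ := hz
    rcases eq_or_ne l k with rfl | hlk
    · simp only [T₃, hψz' _ _ hl, zero_mul, mul_zero]
    · have : ∏ l ∈ Finset.univ.erase k, ψ l (z l) = 0 :=
        Finset.prod_eq_zero (Finset.mem_erase.2 ⟨hlk, Finset.mem_univ l⟩) (hψz l _ hl)
      simp only [T₃, this, zero_mul, mul_zero]
  have i₃ : ∀ k, Integrable (T₃ k) := by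
    intro k
    refine h_int _ (((cΦ.mul hHh.continuous).mul hSQ.continuous).mul ((Continuous.mul ?_ ?_).mul
      (cdk k))) (z₃ k)
    · exact ((contDiff_infty_iff_deriv.1 (hψ k)).2.continuous).comp (continuous_apply k)
    · exact continuous_finsetProd _ fun l _ => (hψm l).continuous
  have key := integral_crossDet_gradient_eq_zero hG2 (((hφG.mul hHh).mul hSQ).mul hχ)
    (HasCompactSupport.intro (K := Icc A B) isCompact_Icc fun z hz => by
      rw [hχz z hz, mul_zero])
  change ∫ z, crossDet G z (fun j => pderiv' j
      (fun z => Φ z * H (h z) * (2 * σ (Q z) - 1) * χ z) z) = 0 at key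
  simp_rw [hpt] at key
  rw [integral_add (f := fun z => T₁ z + T₂ z) (i₁.add i₂) (integrable_finsetSum _ fun k _ => i₃ k),
    integral_add i₁ i₂, integral_finsetSum _ fun k _ => i₃ k] at key
  have b₂ : |∫ z, T₂ z| ≤ 2 * M := by
    refine abs_integral_le_of_setLIntegral_le measurableSet_Icc (by norm_num) hM
      (fun z _ => ?_) (fun z hz => ?_) (hMQ _ hσb)
    · have e : T₂ z = 2 * (deriv σ (Q z) * φ (fun i => G i z) *
        crossDet G z fun j => pderiv' j Q z) * (H (h z) * χ z) := by simp only [T₂, Φ]; ring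
      have e' : |H (h z) * χ z| ≤ 1 := by
        rw [abs_of_nonneg (mul_nonneg (hH0 _) (hχ0 z))]
        exact mul_le_one₀ (hH1 _) (hχ0 z) (hχ1 z)
      rw [e, abs_mul, abs_mul, abs_mul (deriv σ (Q z) * _),
        abs_of_nonneg (mul_nonneg (hσb.nonneg _) (hφ0 _)), abs_of_nonneg (zero_le_two (α := ℝ))]
      exact mul_le_of_le_one_right (mul_nonneg zero_le_two (mul_nonneg (mul_nonneg (hσb.nonneg _)
        (hφ0 _)) (abs_nonneg _))) e'
    · simp only [T₂, χ, hχz z hz, mul_zero, zero_mul]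
  have b₃ : ∀ k, |∫ z, T₃ k z| ≤ 2 * M := by
    intro k
    rw [← one_mul (2 * M)]
    refine abs_integral_le_of_setLIntegral_le measurableSet_Icc zero_le_one (by positivity)
      (g := fun z => s₁ k (z k) * φ (fun i => G i z) * |crossDet G z (Pi.single k 1)| +
        s₂ k (z k) * φ (fun i => G i z) * |crossDet G z (Pi.single k 1)|)
      (fun z _ => ?_) (z₃ k) ?_
    · have e : T₃ k z = (φ (fun i => G i z) * crossDet G z (Pi.single k 1)) *
        (H (h z) * (2 * σ (Q z) - 1) * (∏ l ∈ Finset.univ.erase k, ψ l (z l))) *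
          deriv (ψ k) (z k) := by simp only [T₃, Φ]; ring
      have e' : |H (h z) * (2 * σ (Q z) - 1) * (∏ l ∈ Finset.univ.erase k, ψ l (z l))| ≤ 1 := by
        rw [abs_mul, abs_mul]
        exact mul_le_one₀ (mul_le_one₀ (hHa _) (abs_nonneg _) (hS1 _)) (abs_nonneg _) (hχe z k)
      rw [one_mul, e, abs_mul, abs_mul, abs_mul, abs_of_nonneg (hφ0 _), ← add_mul, ← add_mul]
      calc _ ≤ φ (fun i => G i z) * |crossDet G z (Pi.single k 1)| * 1 *
            (s₁ k (z k) + s₂ k (z k)) := by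
            have := hφ0 fun i => G i z
            gcongr
            exact hψd k _
        _ = _ := by ring
    · have m : ∀ s, IsUnitBump s → Measurable fun z : Fin (n + 1) → ℝ =>
          s (z k) * φ (fun i => G i z) * |crossDet G z (Pi.single k 1)| := fun s hs =>
        (((hs.contDiff.continuous.comp (continuous_apply k)).mul cΦ).mul (cdk k).abs).measurable
      have p : ∀ s, IsUnitBump s → ∀ z : Fin (n + 1) → ℝ,
          0 ≤ s (z k) * φ (fun i => G i z) * |crossDet G z (Pi.single k 1)| := fun s hs z =>
        mul_nonneg (mul_nonneg (hs.nonneg _) (hφ0 _)) (abs_nonneg _)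
      simp_rw [fun z => ENNReal.ofReal_add (p _ (hs₁ k) z) (p _ (hs₂ k) z)]
      rw [lintegral_add_left (m _ (hs₁ k)).ennreal_ofReal, two_mul, ENNReal.ofReal_add hM hM]
      exact add_le_add (hMk k _ (hs₁ k)) (hMk k _ (hs₂ k))
  have b₄ : |∑ k, ∫ z, T₃ k z| ≤ (n + 1) * (2 * M) := by
    refine (Finset.abs_sum_le_sum_abs _ _).trans ((Finset.sum_le_sum fun k _ => b₃ k).trans ?_)
    simp
  change |∫ z, T₁ z| ≤ _
  have : ∫ z, T₁ z = -(∫ z, T₂ z) - ∑ k, ∫ z, T₃ k z := by linarith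
  rw [this]
  rw [abs_le] at b₂ b₄ ⊢
  constructor <;> linarith [b₂.1, b₂.2, b₄.1, b₄.2]

end RolleStep

section Graph
open Set
open scoped ContDiff

theorem integral_graph_le {n : ℕ} {b : (Fin (n + 1) → ℝ) → ℝ} (hb : Continuous b)
    (hbc : HasCompactSupport b) {f : (Fin n → ℝ) → ℝ} (hf : Continuous f) {K : ℝ}
    (hK : ∀ H : ℝ → ℝ, ContDiff ℝ ∞ H → (∀ t, 0 ≤ H t) → (∀ t, H t ≤ 1) → IsUnitBump (deriv H) →
      |∫ z, deriv H (z 0 - f (Fin.tail z)) * b z| ≤ K) :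
    ∫ x, b (Fin.cons (f x) x) ≤ K := by
  have hcons : Continuous fun p : ℝ × (Fin n → ℝ) => (Fin.cons p.1 p.2 : Fin (n + 1) → ℝ) :=
    continuous_pi fun k => by
      refine Fin.cases ?_ (fun k => ?_) k
      · simpa using continuous_fst
      · simpa using (by fun_prop : Continuous fun a : ℝ × (Fin n → ℝ) => a.2 k)
  have htail : Continuous fun z : Fin (n + 1) → ℝ => Fin.tail z :=
    continuous_pi fun k => continuous_apply k.succ
  let A : ℝ → ℝ := fun s => ∫ x, b (Fin.cons (s + f x) x)
  let S : Set (Fin n → ℝ) := Fin.tail '' tsupport b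
  have hS : IsCompact S := hbc.isCompact.image htail
  have hbS : ∀ y, ∀ x ∉ S, b (Fin.cons y x) = 0 := by
    intro y x hx
    by_contra h
    exact hx ⟨Fin.cons y x, subset_tsupport _ h, Fin.tail_cons _ _⟩
  have cb : Continuous fun p : ℝ × (Fin n → ℝ) => b (Fin.cons (p.1 + f p.2) p.2) :=
    hb.comp (hcons.comp ((continuous_fst.add (hf.comp continuous_snd)).prodMk continuous_snd))
  have cA : Continuous A := by
    have e : A = fun s => ∫ x in S, b (Fin.cons (s + f x) x) := funext fun s =>
      (setIntegral_eq_integral_of_forall_compl_eq_zero fun x hx => hbS _ x hx).symm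
    rw [e]
    exact continuous_parametric_integral_of_continuous
      (f := fun s x => b (Fin.cons (s + f x) x)) cb hS
  have hA0 : A 0 = ∫ x, b (Fin.cons (f x) x) := by simp only [A, zero_add]
  rw [← hA0]
  by_contra! hlt
  obtain ⟨K', hK1, hK2⟩ := exists_between hlt
  obtain ⟨τ, hτ, hτA⟩ := Metric.eventually_nhds_iff.1 (cA.continuousAt.eventually_const_lt hK2)
  obtain ⟨H, H1, H2, H3, H4, H5, H6, H7⟩ := exists_smooth_transition_isUnitBump (half_pos hτ)
  have hle := hK H H1 H4 H5 H7
  have cH := H7.contDiff.continuous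
  have e : ∫ z, deriv H (z 0 - f (Fin.tail z)) * b z = ∫ s, deriv H s * A s := by
    rw [integral_fin_succ_eq (fun z => deriv H (z 0 - f (Fin.tail z)) * b z)
      ((cH.comp ((continuous_apply 0).sub (hf.comp htail))).mul hb)
      hbc.mul_left]
    have e1 : ∀ x : Fin n → ℝ, ∫ y, deriv H ((Fin.cons y x : Fin (n + 1) → ℝ) 0 -
        f (Fin.tail (Fin.cons y x : Fin (n + 1) → ℝ))) * b (Fin.cons y x) =
        ∫ s, deriv H s * b (Fin.cons (s + f x) x) := by
      intro x
      rw [← integral_add_right_eq_self _ (f x)]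
      simp
    simp_rw [e1]
    rw [integral_integral_swap_of_hasCompactSupport]
    · simp_rw [integral_const_mul, A]
    · exact (cH.comp continuous_snd).mul (cb.comp (continuous_snd.prodMk continuous_fst))
    · refine HasCompactSupport.intro (hS.prod H7.hasCompactSupport.isCompact) fun p hp => ?_
      rw [mem_prod, not_and_or] at hp
      rcases hp with hp | hp
      · change deriv H p.2 * b (Fin.cons (p.2 + f p.1) p.1) = 0
        rw [hbS _ _ hp, mul_zero]
      · change deriv H p.2 * b (Fin.cons (p.2 + f p.1) p.1) = 0
        rw [image_eq_zero_of_notMem_tsupport hp, zero_mul]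
  have i1 : Integrable (deriv H) := cH.integrable_of_hasCompactSupport H7.hasCompactSupport
  have i2 : Integrable fun s => deriv H s * A s :=
    (cH.mul cA).integrable_of_hasCompactSupport H7.hasCompactSupport.mul_right
  have : K' ≤ ∫ s, deriv H s * A s := by
    calc K' = ∫ s, deriv H s * K' := by rw [integral_mul_const, H7.integral_eq, one_mul]
      _ ≤ _ := by
        refine integral_mono (i1.mul_const _) i2 fun s => ?_
        by_cases hs : s ∈ Icc 0 (τ / 2)
        · refine mul_le_mul_of_nonneg_left (hτA ?_).le (H7.nonneg s)
          rw [Real.dist_eq, sub_zero, abs_of_nonneg hs.1]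
          linarith [hs.2]
        · simp [H6 s hs]
  rw [e, abs_le] at hle
  linarith [hle.2]

/-- Integrated Khovanskii–Rolle inequality on the graph of `f`. -/
theorem setLIntegral_graph_le {n : ℕ} {G : Fin n → (Fin (n + 1) → ℝ) → ℝ}
    (hG : ∀ i, ContDiff ℝ ∞ (G i)) {Q : (Fin (n + 1) → ℝ) → ℝ} (hQ : ContDiff ℝ ∞ Q)
    {f : (Fin n → ℝ) → ℝ} (hf : ContDiff ℝ ∞ f)
    {φ : (Fin n → ℝ) → ℝ} (hφ : ContDiff ℝ 1 φ) (hφ0 : ∀ p, 0 ≤ φ p)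
    {A B : Fin (n + 1) → ℝ} {u v : Fin n → ℝ} (hu : ∀ k, A k.succ < u k) (hv : ∀ k, v k < B k.succ)
    {a b : ℝ} (ha : A 0 < a) (hb : b < B 0) (hfab : ∀ x ∈ Icc u v, f x ∈ Icc a b)
    (hQf : ∀ x, Fin.cons (f x) x ∈ Icc A B → Q (Fin.cons (f x) x) =
      crossDet G (Fin.cons (f x) x) fun j => pderiv' j (fun z => z 0 - f (Fin.tail z))
        (Fin.cons (f x) x)) {M : ℝ} (hM : 0 ≤ M)
    (hMQ : ∀ s, IsUnitBump s → ∫⁻ z in Icc A B, ENNReal.ofReal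
      (s (Q z) * φ (fun i => G i z) * |crossDet G z fun j => pderiv' j Q z|) ≤ ENNReal.ofReal M)
    (hMk : ∀ k, ∀ s, IsUnitBump s → ∫⁻ z in Icc A B, ENNReal.ofReal
      (s (z k) * φ (fun i => G i z) * |crossDet G z (Pi.single k 1)|) ≤ ENNReal.ofReal M) :
    ∫⁻ x in Icc u v, ENNReal.ofReal (φ (fun i => G i (Fin.cons (f x) x)) *
      |Q (Fin.cons (f x) x)|) ≤ ENNReal.ofReal ((2 + 2 * (n + 1)) * M) := by
  let u' : Fin (n + 1) → ℝ := Fin.cons a u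
  let v' : Fin (n + 1) → ℝ := Fin.cons b v
  have hu' : ∀ k, A k < u' k := Fin.cases ha hu
  have hv' : ∀ k, v' k < B k := Fin.cases hb hv
  choose ψ s₁ s₂ p1 p2 p3 p4 p5 p6 p7 p8 using fun k => exists_smooth_cutoff (hu' k) (hv' k)
  let h : (Fin (n + 1) → ℝ) → ℝ := fun z => z 0 - f (Fin.tail z)
  have hh : ContDiff ℝ ∞ h :=
    (contDiff_apply ℝ ℝ 0).sub (hf.comp (contDiff_pi.2 fun k => contDiff_apply ℝ ℝ k.succ))
  have hG2 : ∀ i, ContDiff ℝ 2 (G i) := fun i => (hG i).of_le (by norm_cast)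
  let Φ : (Fin (n + 1) → ℝ) → ℝ := fun z => φ fun i => G i z
  let χ : (Fin (n + 1) → ℝ) → ℝ := fun z => ∏ k, ψ k (z k)
  have cΦ : Continuous Φ := hφ.continuous.comp (continuous_pi fun i => (hG i).continuous)
  have cχ : Continuous χ :=
    continuous_finsetProd _ fun k _ => (p1 k).continuous.comp (continuous_apply k)
  have hχz : ∀ z ∉ Icc A B, χ z = 0 := by
    intro z hz
    rw [← pi_univ_Icc, mem_univ_pi] at hz
    push Not at hz
    obtain ⟨k, hk⟩ := hz
    exact Finset.prod_eq_zero (Finset.mem_univ k) (p4 k _ hk)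
  have hχ0 : ∀ z, 0 ≤ χ z := fun z => Finset.prod_nonneg fun k _ => p6 k _
  have cg : Continuous fun x => (Fin.cons (f x) x : Fin (n + 1) → ℝ) :=
    continuous_pi (Fin.cases (by simpa using hf.continuous)
      fun k => by simpa using continuous_apply k)
  have h_int : ∀ F : (Fin (n + 1) → ℝ) → ℝ, Continuous F → (∀ z ∉ Icc A B, F z = 0) →
      Integrable fun x => F (Fin.cons (f x) x) := by
    intro F hF h0
    refine (hF.comp cg).integrable_of_hasCompactSupport
      (HasCompactSupport.intro (isCompact_Icc (a := Fin.tail A) (b := Fin.tail B))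
        fun x hx => h0 _ fun hx' => hx ⟨fun k => ?_, fun k => ?_⟩)
    · simpa [Fin.tail] using hx'.1 k.succ
    · simpa [Fin.tail] using hx'.2 k.succ
  have i1 : Integrable fun x => Φ (Fin.cons (f x) x) * |Q (Fin.cons (f x) x)| *
      χ (Fin.cons (f x) x) :=
    h_int (fun z => Φ z * |Q z| * χ z) ((cΦ.mul hQ.continuous.abs).mul cχ)
      fun z hz => by simp [hχz z hz]
  have i2 : Integrable fun x => Φ (Fin.cons (f x) x) * χ (Fin.cons (f x) x) :=
    h_int (fun z => Φ z * χ z) (cΦ.mul cχ) fun z hz => by simp [hχz z hz]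
  set K := (2 + 2 * ((n : ℝ) + 1)) * M with hKdef
  have main : ∀ ε > 0, ∫ x, Φ (Fin.cons (f x) x) * |Q (Fin.cons (f x) x)| *
      χ (Fin.cons (f x) x) ≤ K + ε * (2 * ∫ x, Φ (Fin.cons (f x) x) * χ (Fin.cons (f x) x)) := by
    intro ε hε
    obtain ⟨σ, c1, z1, o1, n1, l1, -, u1⟩ := exists_smooth_transition_isUnitBump hε
    let w : (Fin (n + 1) → ℝ) → ℝ := fun z =>
      Φ z * crossDet G z (fun j => pderiv' j h z) * (2 * σ (Q z) - 1) * χ z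
    have cw : Continuous w :=
      ((cΦ.mul (continuous_crossDet hG2 (continuous_pi fun j =>
        (hh.pderiv' (m := 1) (by norm_cast) j).continuous))).mul ((continuous_const.mul
        (c1.continuous.comp hQ.continuous)).sub continuous_const)).mul cχ
    have wz : ∀ z ∉ Icc A B, w z = 0 := fun z hz => by simp [w, hχz z hz]
    have := integral_graph_le cw (HasCompactSupport.intro isCompact_Icc wz) hf.continuous
      fun H H1 H2 H3 H4 => abs_integral_crossDet_le hG hQ hh hφ hφ0 hM hMQ hMk H1 H2 H3 c1 n1 l1 u1
        p1 p2 p3 p4 p6 p7 p8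
    have i3 := h_int w cw wz
    have hle : ∫ x, (Φ (Fin.cons (f x) x) * |Q (Fin.cons (f x) x)| * χ (Fin.cons (f x) x) -
        ε * (2 * (Φ (Fin.cons (f x) x) * χ (Fin.cons (f x) x)))) ≤ ∫ x, w (Fin.cons (f x) x) := by
      refine integral_mono (i1.sub ((i2.const_mul 2).const_mul ε)) i3 fun x => ?_
      by_cases hx : Fin.cons (f x) x ∈ Icc A B
      · simp only [w]
        rw [show crossDet G (Fin.cons (f x) x) (fun j => pderiv' j h (Fin.cons (f x) x)) =
          Q (Fin.cons (f x) x) from (hQf x hx).symm]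
        generalize Q (Fin.cons (f x) x) = q
        have hq : |q| - 2 * ε ≤ q * (2 * σ q - 1) := by
          rcases le_total q 0 with h0 | h0
          · rw [z1 q h0, abs_of_nonpos h0]; linarith
          · rw [abs_of_nonneg h0]
            rcases le_total ε q with h1 | h1
            · rw [o1 q h1]; linarith
            · nlinarith [mul_nonneg h0 (n1 q)]
        have h0 : 0 ≤ Φ (Fin.cons (f x) x) * χ (Fin.cons (f x) x) := mul_nonneg (hφ0 _) (hχ0 _)
        nlinarith [mul_le_mul_of_nonneg_left hq h0]
      · simp [w, hχz _ hx]
    rw [integral_sub i1 ((i2.const_mul 2).const_mul ε), integral_const_mul,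
      integral_const_mul] at hle
    linarith
  have fin : ∫ x, Φ (Fin.cons (f x) x) * |Q (Fin.cons (f x) x)| * χ (Fin.cons (f x) x) ≤ K := by
    set c := 2 * ∫ x, Φ (Fin.cons (f x) x) * χ (Fin.cons (f x) x)
    have ht : Filter.Tendsto (fun ε : ℝ => K + ε * c) (nhdsWithin 0 (Ioi 0)) (nhds K) := by
      have : Continuous fun ε : ℝ => K + ε * c := by fun_prop
      simpa using (this.tendsto 0).mono_left nhdsWithin_le_nhds
    exact ge_of_tendsto ht (by filter_upwards [self_mem_nhdsWithin] with ε hε using main ε hε)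
  calc _ ≤ ∫⁻ x in Icc u v, ENNReal.ofReal (Φ (Fin.cons (f x) x) * |Q (Fin.cons (f x) x)| *
        χ (Fin.cons (f x) x)) := by
        refine setLIntegral_mono' measurableSet_Icc fun x hx => ?_
        have : χ (Fin.cons (f x) x) = 1 := Finset.prod_eq_one fun k _ => p5 k _ (by
          refine Fin.cases ?_ (fun k => ?_) k
          · simpa [u', v'] using hfab x hx
          · simpa [u', v'] using ⟨hx.1 k, hx.2 k⟩)
        rw [this, mul_one]
    _ ≤ ∫⁻ x, ENNReal.ofReal (Φ (Fin.cons (f x) x) * |Q (Fin.cons (f x) x)| *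
        χ (Fin.cons (f x) x)) := setLIntegral_le_lintegral _ _
    _ ≤ _ := by
        rw [← ofReal_integral_eq_lintegral_ofReal i1 (Filter.Eventually.of_forall fun x =>
          mul_nonneg (mul_nonneg (hφ0 _) (abs_nonneg _)) (hχ0 _))]
        exact ENNReal.ofReal_le_ofReal fin

end Graph

section PolynomialCalculus
open MvPolynomial
open scoped ContDiff

theorem totalDegree_pderiv_le {σ : Type*} (i : σ) (P : MvPolynomial σ ℝ) :
    (pderiv i P).totalDegree ≤ P.totalDegree := by
  conv_lhs => rw [P.as_sum, map_sum]
  refine totalDegree_finsetSum_le fun m hm => ?_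
  rw [pderiv_monomial]
  refine (totalDegree_monomial_le _ _).trans (le_trans ?_ (le_totalDegree hm))
  have h : m - Finsupp.single i 1 + (m - (m - Finsupp.single i 1)) = m :=
    add_tsub_cancel_of_le tsub_le_self
  conv_rhs => rw [← h, Finsupp.sum_add_index' (by simp) (by simp)]
  exact Nat.le_add_right _ _

theorem totalDegree_det_le {σ : Type*} {m D : ℕ} (A : Matrix (Fin m) (Fin m) (MvPolynomial σ ℝ))
    (hA : ∀ i j, (A i j).totalDegree ≤ D) : A.det.totalDegree ≤ m * D := by
  rw [Matrix.det_apply']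
  refine totalDegree_finsetSum_le fun τ _ => (totalDegree_mul _ _).trans ?_
  have h : ((((Equiv.Perm.sign τ : ℤˣ) : ℤ) : MvPolynomial σ ℝ)).totalDegree = 0 := by
    rw [← map_intCast (C : ℝ →+* MvPolynomial σ ℝ)]
    exact totalDegree_C _
  rw [h, zero_add]
  refine (totalDegree_finsetProd _ _).trans ((Finset.sum_le_sum fun i _ => hA _ _).trans ?_)
  simp

theorem contDiff_eval_mvPolynomial {σ E : Type*} [NormedAddCommGroup E] [NormedSpace ℝ E]
    {k : WithTop ℕ∞} {F : E → σ → ℝ} (hF : ∀ s, ContDiff ℝ k fun x => F x s)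
    (P : MvPolynomial σ ℝ) : ContDiff ℝ k fun x => eval (F x) P := by
  induction P using MvPolynomial.induction_on with
  | C a => simpa using contDiff_const
  | add p q hp hq => simpa using hp.add hq
  | mul_X p s hp => simpa using hp.mul (hF s)

theorem hasFDerivAt_eval_mvPolynomial {σ E : Type*} [Fintype σ] [NormedAddCommGroup E]
    [NormedSpace ℝ E] {F : E → σ → ℝ} {F' : σ → E →L[ℝ] ℝ} {x : E}
    (hF : ∀ s, HasFDerivAt (fun x => F x s) (F' s) x) (P : MvPolynomial σ ℝ) :
    HasFDerivAt (fun x => eval (F x) P) (∑ s, eval (F x) (pderiv s P) • F' s) x := by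
  classical
  induction P using MvPolynomial.induction_on with
  | C a => simpa using hasFDerivAt_const a x
  | add p q hp hq =>
    simp only [map_add, add_smul, Finset.sum_add_distrib]
    exact hp.add hq
  | mul_X p s hp =>
    have := hp.mul (hF s)
    simp only [map_mul, eval_X]
    refine this.congr_fderiv ?_
    simp only [pderiv_mul, pderiv_X, map_add, map_mul, eval_X, add_smul, Finset.sum_add_distrib,
      Finset.smul_sum]
    rw [add_comm]
    congr 1
    · exact Finset.sum_congr rfl fun t _ => by rw [smul_smul, mul_comm]
    · rw [Finset.sum_eq_single s]
      · simp
      · intro t _ ht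
        simp [ht.symm]
      · simp

/-- The formal `j`-th partial derivative of a polynomial in the coordinates and in functions with
partial derivatives `g`. -/
noncomputable def chainPderiv {n r : ℕ} (g : Fin r → Fin n → MvPolynomial (Fin n ⊕ Fin r) ℝ)
    (j : Fin n) (P : MvPolynomial (Fin n ⊕ Fin r) ℝ) : MvPolynomial (Fin n ⊕ Fin r) ℝ :=
  pderiv (Sum.inl j) P + ∑ k, pderiv (Sum.inr k) P * g k j

theorem totalDegree_chainPderiv_le {n r a D : ℕ}
    {g : Fin r → Fin n → MvPolynomial (Fin n ⊕ Fin r) ℝ} (hg : ∀ k i, (g k i).totalDegree ≤ a)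
    (j : Fin n) {P : MvPolynomial (Fin n ⊕ Fin r) ℝ} (hP : P.totalDegree ≤ D) :
    (chainPderiv g j P).totalDegree ≤ D + a := by
  refine (totalDegree_add _ _).trans (max_le ?_ ?_)
  · exact (totalDegree_pderiv_le _ _).trans (hP.trans (Nat.le_add_right _ _))
  · refine totalDegree_finsetSum_le fun k _ => (totalDegree_mul _ _).trans ?_
    exact add_le_add ((totalDegree_pderiv_le _ _).trans hP) (hg k j)

theorem pderiv'_eval_chain {n r : ℕ} {f : Fin r → (Fin n → ℝ) → ℝ}
    {g : Fin r → Fin n → MvPolynomial (Fin n ⊕ Fin r) ℝ} {x : Fin n → ℝ}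
    (hf : ∀ k, DifferentiableAt ℝ (f k) x)
    (hg : ∀ k i, pderiv' i (f k) x = eval (Sum.elim x fun k => f k x) (g k i))
    (P : MvPolynomial (Fin n ⊕ Fin r) ℝ) (j : Fin n) :
    pderiv' j (fun x => eval (Sum.elim x fun k => f k x) P) x =
      eval (Sum.elim x fun k => f k x) (chainPderiv g j P) := by
  have h : HasFDerivAt (fun x => eval (Sum.elim x fun k => f k x) P) _ x :=
    hasFDerivAt_eval_mvPolynomial (F := fun x => Sum.elim x fun k => f k x)
      (F' := Sum.elim (fun i => ContinuousLinearMap.proj (R := ℝ) (φ := fun _ => ℝ) i)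
        fun k => fderiv ℝ (f k) x)
      (Sum.rec (fun i => hasFDerivAt_apply i x) fun k => (hf k).hasFDerivAt) P
  rw [pderiv', h.fderiv]
  have e : ∀ k, fderiv ℝ (f k) x (Pi.single j 1) = eval (Sum.elim x fun k => f k x) (g k j) :=
    fun k => hg k j
  simp [sum_apply, Fintype.sum_sum_type, chainPderiv, e, Pi.single_apply]

/-- A globally smooth version of a Pfaffian chain, whose differential relations hold on `U`. -/
def IsSmoothChain {d : ℕ} (U : Set (Fin d → ℝ)) (r a : ℕ) (f : Fin r → (Fin d → ℝ) → ℝ) : Prop :=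
  (∀ j, ContDiff ℝ ∞ (f j)) ∧
  ∀ j : Fin r, ∃ g : Fin d → MvPolynomial (Fin d ⊕ Fin (j + 1)) ℝ,
    (∀ i, (g i).totalDegree ≤ a) ∧
    ∀ x ∈ U, ∀ i, pderiv' i (f j) x =
      eval (Sum.elim x fun k : Fin (j + 1) => f (k.castLE j.isLt) x) (g i)

theorem exists_chain_coefficients {d : ℕ} {U : Set (Fin d → ℝ)} {r a : ℕ}
    {f : Fin r → (Fin d → ℝ) → ℝ}
    (h : ∀ j : Fin r, ∃ g : Fin d → MvPolynomial (Fin d ⊕ Fin (j + 1)) ℝ,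
      (∀ i, (g i).totalDegree ≤ a) ∧ ∀ x ∈ U, ∀ i, pderiv' i (f j) x =
        eval (Sum.elim x fun k : Fin (j + 1) => f (k.castLE j.isLt) x) (g i)) :
    ∃ g : Fin r → Fin d → MvPolynomial (Fin d ⊕ Fin r) ℝ, (∀ k i, (g k i).totalDegree ≤ a) ∧
      ∀ x ∈ U, ∀ k i, pderiv' i (f k) x = eval (Sum.elim x fun k => f k x) (g k i) := by
  choose g hg hf using h
  refine ⟨fun k i => rename (Sum.map id (Fin.castLE k.isLt)) (g k i),
    fun k i => (totalDegree_rename_le _ _).trans (hg k i), fun x hx k i => ?_⟩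
  rw [hf k x hx i, eval_rename]
  congr 2
  funext s
  rcases s with s | s <;> rfl

/-- Replacing the last function of a chain by a new coordinate gives a chain of smaller order. -/
theorem IsSmoothChain.lift {n r a : ℕ} {U : Set (Fin n → ℝ)} {f : Fin (r + 1) → (Fin n → ℝ) → ℝ}
    (hf : IsSmoothChain U (r + 1) a f) :
    IsSmoothChain (Fin.tail ⁻¹' U : Set (Fin (n + 1) → ℝ)) r a
      fun k z => f k.castSucc (Fin.tail z) := by
  have htail : ContDiff ℝ ∞ fun z : Fin (n + 1) → ℝ => (Fin.tail z : Fin n → ℝ) :=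
    contDiff_pi.2 fun k => contDiff_apply ℝ ℝ k.succ
  refine ⟨fun j => (hf.1 _).comp htail, fun j => ?_⟩
  obtain ⟨g, hg, hgf⟩ := hf.2 j.castSucc
  refine ⟨Fin.cons 0 fun i => rename (Sum.map Fin.succ id) (g i), ?_, fun z hz i => ?_⟩
  · refine Fin.cases (by simp) fun i => ?_
    simpa using (totalDegree_rename_le _ _).trans (hg i)
  · let T : (Fin (n + 1) → ℝ) →L[ℝ] (Fin n → ℝ) :=
      ContinuousLinearMap.pi fun k => ContinuousLinearMap.proj k.succ
    have hd : HasFDerivAt (fun z : Fin (n + 1) → ℝ => f j.castSucc (Fin.tail z))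
        ((fderiv ℝ (f j.castSucc) (Fin.tail z)).comp T) z :=
      ((hf.1 j.castSucc).differentiable (by simp) (Fin.tail z)).hasFDerivAt.comp z
        T.hasFDerivAt
    rw [pderiv', hd.fderiv, ContinuousLinearMap.comp_apply]
    refine Fin.cases ?_ (fun i => ?_) i
    · have : T (Pi.single 0 1) = 0 := by
        funext k; simp [T]
      simp [this]
    · have : T (Pi.single i.succ 1) = Pi.single i 1 := by
        funext k; simp [T, Pi.single_apply]
      rw [this]
      refine (hgf _ hz i).trans ?_
      rw [Fin.cons_succ, eval_rename]
      congr 2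
      funext s
      rcases s with s | s <;> rfl

theorem det_cons_col_add {n : ℕ} {R : Type*} [CommRing R] (w c : Fin n → R)
    (A : Matrix (Fin n) (Fin n) R) :
    (Matrix.of (Fin.cons (Fin.cons 1 fun j => -w j) fun i => Fin.cons (c i) fun j => A i j) :
      Matrix (Fin (n + 1)) (Fin (n + 1)) R).det =
      (Matrix.of fun i j => A i j + w j * c i).det := by
  have h := Matrix.det_eq_of_forall_row_eq_smul_add_const
    (A := (Matrix.of (Fin.cons (Fin.cons 1 fun j => -w j) fun i => Fin.cons (c i) fun j => A i j) :
      Matrix (Fin (n + 1)) (Fin (n + 1)) R).transpose)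
    (B := (Matrix.of (Fin.cons (Fin.cons 1 fun _ => 0) fun i => Fin.cons (c i)
      fun j => A i j + w j * c i) : Matrix (Fin (n + 1)) (Fin (n + 1)) R).transpose)
    (Fin.cons 0 fun j => -w j) 0 (by simp) (by
      intro i j
      refine Fin.cases ?_ (fun i => ?_) i <;> refine Fin.cases ?_ (fun j => ?_) j <;> simp)
  rw [Matrix.det_transpose, Matrix.det_transpose] at h
  rw [h, Matrix.det_succ_row_zero, Fin.sum_univ_succ]
  simp
  rfl

end PolynomialCalculus

section Khovanskii
open MvPolynomial Set
open scoped ContDiff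

theorem exists_Icc_sub_add_subset {n : ℕ} {U : Set (Fin n → ℝ)} (hU : IsOpen U) {u v : Fin n → ℝ}
    (huv : u ≤ v) (h : Icc u v ⊆ U) :
    ∃ η > 0, Icc (fun k => u k - η) (fun k => v k + η) ⊆ U := by
  obtain ⟨η, hη, hsub⟩ := isCompact_Icc.exists_cthickening_subset_open hU h
  refine ⟨η, hη, fun x hx => hsub ?_⟩
  refine Metric.mem_cthickening_of_dist_le x (fun k => max (u k) (min (v k) (x k))) η _
    ⟨fun k => le_max_left _ _, fun k => max_le (huv k) (min_le_left _ _)⟩ ?_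
  refine (dist_pi_le_iff hη.le).2 fun k => ?_
  have h1 := hx.1 k
  have h2 := hx.2 k
  have h3 := huv k
  rw [Real.dist_eq, abs_le]
  rcases max_cases (u k) (min (v k) (x k)) with h4 | h4 <;>
    rcases min_cases (v k) (x k) with h5 | h5 <;> constructor <;> linarith

/-- Integrated Bézout bound: base case of the Khovanskii induction. -/
theorem exists_setLIntegral_polynomial_jacobian_le (n D : ℕ) :
    ∃ N : ℕ, ∀ P : Fin n → MvPolynomial (Fin n) ℝ, (∀ i, (P i).totalDegree ≤ D) →
      ∀ s : Set (Fin n → ℝ), MeasurableSet s → ∀ φ : (Fin n → ℝ) → ℝ, Measurable φ →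
      (∀ p, 0 ≤ φ p) →
      ∫⁻ x in s, ENNReal.ofReal (φ (fun i => eval x (P i)) *
        |(Matrix.of fun i j => pderiv' j (fun x => eval x (P i)) x).det|) ≤
          N * ∫⁻ p, ENNReal.ofReal (φ p) := by
  obtain ⟨N, hN⟩ := exists_ae_encard_fiber_polynomial_le n D
  refine ⟨N, fun P hP s hs φ hφ hφ0 => ?_⟩
  have hsm : ∀ i, ContDiff ℝ ∞ fun x => eval x (P i) := fun i =>
    contDiff_eval_mvPolynomial (F := fun x : Fin n → ℝ => x) (fun s => contDiff_apply ℝ ℝ s) (P i)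
  let f : (Fin n → ℝ) → Fin n → ℝ := fun x i => eval x (P i)
  have hf : ContDiff ℝ ∞ f := contDiff_pi.2 hsm
  have hf' : ∀ x, HasFDerivAt f (fderiv ℝ f x) x := fun x =>
    (hf.differentiable (by simp) x).hasFDerivAt
  have hdet : ∀ x, (fderiv ℝ f x).det =
      (Matrix.of fun i j => pderiv' j (fun x => eval x (P i)) x).det := by
    intro x
    rw [ContinuousLinearMap.det, ← LinearMap.det_toMatrix']
    congr 1
    ext i j
    rw [LinearMap.toMatrix'_apply]
    have := (hasFDerivAt_pi'.1 (hf' x) i).fderiv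
    simp only [Matrix.of_apply, pderiv']
    rw [show (fun x => eval x (P i)) = fun x => f x i from rfl, this]
    rfl
  have hc : Continuous fun x => (fderiv ℝ f x).det :=
    ContinuousLinearMap.continuous_det.comp (hf.continuous_fderiv (by simp))
  have := lintegral_abs_det_fderiv_mul_le_of_encard_fiber_le hs hf' hc.measurable N (hN P hP)
    (fun p => ENNReal.ofReal (φ p)) hφ.ennreal_ofReal
  refine le_trans (le_of_eq ?_) this
  refine lintegral_congr fun x => ?_
  rw [← ENNReal.ofReal_mul (abs_nonneg _), hdet, mul_comm]

/-- Integrated Khovanskii bound for maps which are polynomial in a smooth Pfaffian chain. -/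
theorem exists_setLIntegral_chain_jacobian_le (r : ℕ) : ∀ n a D : ℕ, ∃ N : ℕ,
    ∀ (U : Set (Fin n → ℝ)) (f : Fin r → (Fin n → ℝ) → ℝ), IsOpen U → IsSmoothChain U r a f →
    ∀ P : Fin n → MvPolynomial (Fin n ⊕ Fin r) ℝ, (∀ i, (P i).totalDegree ≤ D) →
    ∀ u v : Fin n → ℝ, Icc u v ⊆ U → ∀ φ : (Fin n → ℝ) → ℝ, ContDiff ℝ 1 φ → HasCompactSupport φ →
    (∀ p, 0 ≤ φ p) →
    ∫⁻ x in Icc u v, ENNReal.ofReal (φ (fun i => eval (Sum.elim x fun k => f k x) (P i)) *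
      |(Matrix.of fun i j =>
        pderiv' j (fun x => eval (Sum.elim x fun k => f k x) (P i)) x).det|) ≤
      N * ∫⁻ p, ENNReal.ofReal (φ p) := by
  induction r with
  | zero =>
    intro n a D
    obtain ⟨N, hN⟩ := exists_setLIntegral_polynomial_jacobian_le n D
    refine ⟨N, fun U f _ _ P hP u v _ φ hφ _ hφ0 => ?_⟩
    have e : ∀ x i, eval (Sum.elim x fun k => f k x) (P i) =
        eval x (rename (Sum.elim id Fin.elim0) (P i)) := by
      intro x i
      rw [eval_rename]
      congr 2
      funext s
      rcases s with s | s
      · rfl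
      · exact s.elim0
    simp_rw [e]
    exact hN _ (fun i => (totalDegree_rename_le _ _).trans (hP i)) _ measurableSet_Icc φ
      hφ.continuous.measurable hφ0
  | succ r ih =>
    intro n a D
    obtain ⟨N, hN⟩ := ih (n + 1) a (max (max D 1) ((n + 1) * (a + D)))
    refine ⟨(2 + 2 * (n + 1)) * N, fun U f hU hf P hP u v huvU φ hφ hφc hφ0 => ?_⟩
    by_cases huv : u ≤ v
    swap
    · rw [Icc_eq_empty huv]; simp
    obtain ⟨η, hη, hηU⟩ := exists_Icc_sub_add_subset hU huv huvU
    let fl := f (Fin.last r)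
    have hfl : ContDiff ℝ ∞ fl := hf.1 _
    obtain ⟨R, hR⟩ := isCompact_Icc.exists_bound_of_continuousOn (s := Icc u v)
      hfl.continuous.continuousOn
    let F : Fin r → (Fin (n + 1) → ℝ) → ℝ := fun k z => f k.castSucc (Fin.tail z)
    let U' : Set (Fin (n + 1) → ℝ) := Fin.tail ⁻¹' U
    have hF : IsSmoothChain U' r a F := hf.lift
    obtain ⟨g, hg, hgF⟩ := exists_chain_coefficients hF.2
    obtain ⟨gl, hgl, hglf⟩ : ∃ gl : Fin n → MvPolynomial (Fin n ⊕ Fin (r + 1)) ℝ,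
        (∀ i, (gl i).totalDegree ≤ a) ∧
        ∀ x ∈ U, ∀ i, pderiv' i fl x = eval (Sum.elim x fun k => f k x) (gl i) :=
      hf.2 (Fin.last r)
    let ρ : Fin n ⊕ Fin (r + 1) → Fin (n + 1) ⊕ Fin r :=
      Sum.elim (fun i => Sum.inl i.succ) (Fin.lastCases (Sum.inl 0) Sum.inr)
    let ev : (Fin (n + 1) → ℝ) → MvPolynomial (Fin (n + 1) ⊕ Fin r) ℝ → ℝ := fun z p =>
      eval (Sum.elim z fun k => F k z) p
    have hev : ∀ p, ContDiff ℝ ∞ fun z => ev z p := fun p =>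
      contDiff_eval_mvPolynomial (F := fun z => Sum.elim z fun k => F k z)
        (Sum.rec (fun i => contDiff_apply ℝ ℝ i) fun k => hF.1 k) p
    have hρ : ∀ x p, ev (Fin.cons (fl x) x) (rename ρ p) = eval (Sum.elim x fun k => f k x) p := by
      intro x p
      simp only [ev, eval_rename]
      congr 2
      funext s
      rcases s with s | s
      · simp [ρ]
      · refine Fin.lastCases ?_ (fun s => ?_) s
        · simp [ρ, fl]
        · simp [ρ, F]
    let G : Fin n → (Fin (n + 1) → ℝ) → ℝ := fun i z => ev z (rename ρ (P i))
    have hG : ∀ i, ContDiff ℝ ∞ (G i) := fun i => hev _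
    let q : MvPolynomial (Fin (n + 1) ⊕ Fin r) ℝ := Matrix.det (Matrix.of
      (Fin.cons (Fin.cons 1 fun j => -rename ρ (gl j)) fun i j =>
        chainPderiv g j (rename ρ (P i))) :
        Matrix (Fin (n + 1)) (Fin (n + 1)) (MvPolynomial (Fin (n + 1) ⊕ Fin r) ℝ))
    have hq : q.totalDegree ≤ (n + 1) * (a + D) := by
      refine totalDegree_det_le _ fun i j => ?_
      refine Fin.cases ?_ (fun i => ?_) i
      · refine Fin.cases ?_ (fun j => ?_) j
        · simp
        · simp only [Matrix.of_apply, Fin.cons_zero, Fin.cons_succ, totalDegree_neg]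
          exact (totalDegree_rename_le _ _).trans ((hgl j).trans (Nat.le_add_right _ _))
      · simp only [Matrix.of_apply, Fin.cons_succ]
        rw [add_comm a D]
        exact totalDegree_chainPderiv_le hg j ((totalDegree_rename_le _ _).trans (hP i))
    have hGd : ∀ z ∈ U', ∀ i j, pderiv' j (G i) z = ev z (chainPderiv g j (rename ρ (P i))) :=
      fun z hz i j => pderiv'_eval_chain (fun k => (hF.1 k).differentiable (by simp) z)
        (hgF z hz) _ j
    let h : (Fin (n + 1) → ℝ) → ℝ := fun z => z 0 - fl (Fin.tail z)
    have hgrad : ∀ x, (fun j => pderiv' j h (Fin.cons (fl x) x)) =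
        Fin.cons 1 fun j => -pderiv' j fl x := by
      intro x
      let T : (Fin (n + 1) → ℝ) →L[ℝ] (Fin n → ℝ) :=
        ContinuousLinearMap.pi fun k => ContinuousLinearMap.proj k.succ
      have hd : HasFDerivAt h (ContinuousLinearMap.proj (R := ℝ) (φ := fun _ => ℝ) 0 -
          (fderiv ℝ fl x).comp T) (Fin.cons (fl x) x) := by
        refine (hasFDerivAt_apply 0 _).sub (HasFDerivAt.comp _ ?_ T.hasFDerivAt)
        have := (hfl.differentiable (by simp) x).hasFDerivAt
        exact this
      funext j
      rw [pderiv', hd.fderiv, sub_apply, ContinuousLinearMap.comp_apply]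
      refine Fin.cases ?_ (fun j => ?_) j
      · have : T (Pi.single 0 1) = 0 := by
          funext k; simp [T]
        simp [this]
      · have : T (Pi.single j.succ 1) = Pi.single j 1 := by
          funext k; simp [T, Pi.single_apply]
        rw [this]
        simp [pderiv']
    have hQ : ∀ x, Fin.tail (Fin.cons (fl x) x : Fin (n + 1) → ℝ) ∈ U → ev (Fin.cons (fl x) x) q =
        crossDet G (Fin.cons (fl x) x) fun j => pderiv' j h (Fin.cons (fl x) x) := by
      intro x hx
      simp only [ev, q, crossDet, RingHom.map_det]
      congr 1
      ext i j
      refine Fin.cases ?_ (fun i => ?_) i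
      · rw [hgrad]
        refine Fin.cases ?_ (fun j => ?_) j
        · simp
        · simpa using (hρ x (gl j)).trans (hglf x hx j).symm
      · simpa using (hGd (Fin.cons (fl x) x) hx i j).symm
    have hDet : ∀ x, crossDet G (Fin.cons (fl x) x) (fun j => pderiv' j h (Fin.cons (fl x) x)) =
        (Matrix.of fun i j =>
          pderiv' j (fun x => eval (Sum.elim x fun k => f k x) (P i)) x).det := by
      intro x
      have hγ : HasFDerivAt (fun x => (Fin.cons (fl x) x : Fin (n + 1) → ℝ))
          (ContinuousLinearMap.pi (Fin.cons (fderiv ℝ fl x) fun k =>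
            ContinuousLinearMap.proj (R := ℝ) (φ := fun _ => ℝ) k)) x :=
        hasFDerivAt_pi.2 (Fin.cases (by simpa using (hfl.differentiable (by simp) x).hasFDerivAt)
          fun k => by simpa using hasFDerivAt_apply k x)
      have e : ∀ i j, pderiv' j (fun x => eval (Sum.elim x fun k => f k x) (P i)) x =
          pderiv' j.succ (G i) (Fin.cons (fl x) x) +
            pderiv' j fl x * pderiv' 0 (G i) (Fin.cons (fl x) x) := by
        intro i j
        have hGi := HasFDerivAt.comp (f := fun x => (Fin.cons (fl x) x : Fin (n + 1) → ℝ)) x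
          ((hG i).differentiable (by simp) (Fin.cons (fl x) x)).hasFDerivAt hγ
        have e1 : (fun x => eval (Sum.elim x fun k => f k x) (P i)) =
            G i ∘ fun x => (Fin.cons (fl x) x : Fin (n + 1) → ℝ) :=
          funext fun x => (hρ x (P i)).symm
        have e2 : (ContinuousLinearMap.pi (Fin.cons (fderiv ℝ fl x) fun k =>
            ContinuousLinearMap.proj (R := ℝ) (φ := fun _ => ℝ) k) :
              (Fin n → ℝ) →L[ℝ] (Fin (n + 1) → ℝ)) (Pi.single j 1) =
            Pi.single j.succ 1 + pderiv' j fl x • Pi.single 0 1 := by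
          funext k
          refine Fin.cases ?_ (fun k => ?_) k
          · simp [pderiv']
          · simp [Pi.single_apply]
        rw [e1, pderiv', hGi.fderiv, ContinuousLinearMap.comp_apply, e2, map_add, map_smul]
        rfl
      simp_rw [e]
      rw [← det_cons_col_add (fun j => pderiv' j fl x)
        (fun i => pderiv' 0 (G i) (Fin.cons (fl x) x))
        (fun i j => pderiv' j.succ (G i) (Fin.cons (fl x) x)), crossDet, hgrad]
      congr 1
      ext i j
      refine Fin.cases ?_ (fun i => ?_) i
      · simp
      · refine Fin.cases ?_ (fun j => ?_) j <;> simp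
    let A : Fin (n + 1) → ℝ := Fin.cons (-R - 1) fun k => u k - η
    let B : Fin (n + 1) → ℝ := Fin.cons (R + 1) fun k => v k + η
    have hAB : ∀ z ∈ Icc A B, Fin.tail z ∈ Icc (fun k => u k - η) fun k => v k + η :=
      fun z hz => ⟨fun k => by simpa [A, Fin.tail] using hz.1 k.succ,
        fun k => by simpa [B, Fin.tail] using hz.2 k.succ⟩
    have hφi : Integrable φ := hφ.continuous.integrable_of_hasCompactSupport hφc
    have hI : ∫⁻ p, ENNReal.ofReal (φ p) = ENNReal.ofReal (∫ p, φ p) :=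
      (ofReal_integral_eq_lintegral_ofReal hφi (Filter.Eventually.of_forall hφ0)).symm
    have hM : 0 ≤ N * ∫ p, φ p := mul_nonneg (Nat.cast_nonneg _) (integral_nonneg hφ0)
    have key : ∀ p : MvPolynomial (Fin (n + 1) ⊕ Fin r) ℝ,
        p.totalDegree ≤ max (max D 1) ((n + 1) * (a + D)) → ∀ s, IsUnitBump s →
        ∫⁻ z in Icc A B, ENNReal.ofReal (s (ev z p) * φ (fun i => G i z) *
          |crossDet G z fun j => pderiv' j (fun z => ev z p) z|) ≤
          ENNReal.ofReal (N * ∫ p, φ p) := by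
      intro p hp s hs
      let Φ : (Fin (n + 1) → ℝ) → ℝ := fun p => s (p 0) * φ (Fin.tail p)
      have hΦ : ContDiff ℝ 1 Φ :=
        ((hs.contDiff.of_le (by exact_mod_cast le_top)).comp (contDiff_apply ℝ ℝ 0)).mul
          (hφ.comp (contDiff_pi.2 fun k => contDiff_apply ℝ ℝ k.succ))
      have hcons : Continuous fun p : ℝ × (Fin n → ℝ) => (Fin.cons p.1 p.2 : Fin (n + 1) → ℝ) :=
        continuous_pi (Fin.cases (by simpa using continuous_fst) fun k => by
          simpa using (by fun_prop : Continuous fun a : ℝ × (Fin n → ℝ) => a.2 k))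
      have hΦc : HasCompactSupport Φ := by
        refine HasCompactSupport.intro
          ((hs.hasCompactSupport.isCompact.prod hφc.isCompact).image hcons) fun p hp => ?_
        by_contra hne
        obtain ⟨h1, h2⟩ := mul_ne_zero_iff.1 hne
        exact hp ⟨(p 0, Fin.tail p), ⟨subset_tsupport _ h1, subset_tsupport _ h2⟩,
          Fin.cons_self_tail p⟩
      have := hN U' F (hU.preimage (continuous_pi fun k => continuous_apply k.succ)) hF
        (Fin.cons p fun i => rename ρ (P i)) (Fin.cases hp fun i =>
          (totalDegree_rename_le _ _).trans ((hP i).trans ((le_max_left _ _).trans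
            (le_max_left _ _)))) A B (fun z hz => hηU (hAB z hz)) Φ hΦ hΦc
        fun p => mul_nonneg (hs.nonneg _) (hφ0 _)
      refine (le_of_eq ?_).trans (this.trans (le_of_eq ?_))
      · refine lintegral_congr fun z => ?_
        congr 3
        rw [crossDet]
        congr 2
        funext i j
        refine Fin.cases ?_ (fun i => ?_) i <;> rfl
      · have e : ∫⁻ p, ENNReal.ofReal (Φ p) = ∫⁻ p : Fin (n + 1) → ℝ,
            ENNReal.ofReal (s (p 0)) * ENNReal.ofReal (φ (Fin.tail p)) :=
          lintegral_congr fun p => ENNReal.ofReal_mul (hs.nonneg _)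
        have e2 : ∫⁻ t, ENNReal.ofReal (s t) = 1 := by
          rw [← ofReal_integral_eq_lintegral_ofReal
            (hs.contDiff.continuous.integrable_of_hasCompactSupport hs.hasCompactSupport)
            (Filter.Eventually.of_forall hs.nonneg), hs.integral_eq, ENNReal.ofReal_one]
        rw [e, lintegral_fin_succ_mul (a := fun t => ENNReal.ofReal (s t))
          (b := fun p => ENNReal.ofReal (φ p)) hs.contDiff.continuous.measurable.ennreal_ofReal
          hφ.continuous.measurable.ennreal_ofReal, e2, one_mul, hI,
          ENNReal.ofReal_mul (Nat.cast_nonneg _), ENNReal.ofReal_natCast]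
    have fin := setLIntegral_graph_le (u := u) (v := v) (a := -R) (b := R) hG (hev q) hfl hφ hφ0
      (A := A) (B := B)
      (fun k => by simpa [A] using hη) (fun k => by simpa [B] using hη) (by simp [A]) (by simp [B])
      (fun x hx => abs_le.1 (hR x hx))
      (fun x hx => hQ x (hηU (hAB _ hx))) hM (key q (hq.trans (le_max_right _ _)))
      (fun k s hs => by
        have e : ∀ z, crossDet G z (Pi.single k 1) = crossDet G z
            fun j => pderiv' j (fun z => ev z (X (Sum.inl k))) z := by
          intro z
          congr 1
          funext j
          simp only [ev, eval_X, Sum.elim_inl, pderiv']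
          rw [(hasFDerivAt_apply k z).fderiv]
          simp [Pi.single_apply, eq_comm]
        have := key (X (Sum.inl k)) ((totalDegree_X _).le.trans
          ((le_max_right _ _).trans (le_max_left _ _))) s hs
        simp_rw [e]
        simpa [ev] using this)
    refine (le_of_eq ?_).trans (fin.trans (le_of_eq ?_))
    · refine setLIntegral_congr_fun measurableSet_Icc fun x hx => ?_
      have hxU : Fin.tail (Fin.cons (fl x) x : Fin (n + 1) → ℝ) ∈ U := by simpa using huvU hx
      simp only [hQ x hxU, hDet, G, hρ]
    · rw [← mul_assoc, ENNReal.ofReal_mul (by positivity), hI]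
      congr 1
      rw [← ENNReal.ofReal_natCast]
      push_cast
      rfl

end Khovanskii

section Sublevel
open MvPolynomial Set
open scoped ContDiff

theorem exists_smooth_box_cutoff {n : ℕ} {a a' b' b : Fin n → ℝ} (h1 : ∀ k, a k < a' k)
    (h2 : ∀ k, b' k < b k) :
    ∃ φ : (Fin n → ℝ) → ℝ, ContDiff ℝ ∞ φ ∧ (∀ x ∉ Icc a b, φ x = 0) ∧
      (∀ x ∈ Icc a' b', φ x = 1) ∧ (∀ x, 0 ≤ φ x) ∧ ∀ x, φ x ≤ 1 := by
  choose ψ s₁ s₂ hψ hs₁ hs₂ hz ho hn hl hd using fun k => exists_smooth_cutoff (h1 k) (h2 k)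
  refine ⟨fun x => ∏ k, ψ k (x k), contDiff_prod fun k _ => (hψ k).comp (contDiff_apply ℝ ℝ k),
    fun x hx => ?_, fun x hx => Finset.prod_eq_one fun k _ => ho k _ ⟨hx.1 k, hx.2 k⟩,
    fun x => Finset.prod_nonneg fun k _ => hn k _,
    fun x => Finset.prod_le_one (fun k _ => hn k _) fun k _ => hl k _⟩
  obtain ⟨k, hk⟩ : ∃ k, x k ∉ Icc (a k) (b k) := by
    by_contra! h
    exact hx ⟨fun k => (h k).1, fun k => (h k).2⟩
  exact Finset.prod_eq_zero (Finset.mem_univ k) (hz k _ hk)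

/-- An analytic Pfaffian chain near the unit cube can be cut off to a globally smooth one. -/
theorem IsPfaffianChain.exists_isSmoothChain {d : ℕ} {U : Set (Fin d → ℝ)} {r a : ℕ}
    {f : Fin r → (Fin d → ℝ) → ℝ} (hf : IsPfaffianChain U r a f) (hU : IsOpen U)
    (hcube : Icc (0 : Fin d → ℝ) 1 ⊆ U) :
    ∃ (V : Set (Fin d → ℝ)) (g : Fin r → (Fin d → ℝ) → ℝ), IsOpen V ∧ Icc (0 : Fin d → ℝ) 1 ⊆ V ∧
      V ⊆ U ∧ IsSmoothChain V r a g ∧ ∀ j, EqOn (g j) (f j) V := by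
  obtain ⟨η, hη, hηU⟩ := exists_Icc_sub_add_subset hU zero_le_one hcube
  obtain ⟨φ, hφ, hφ0, hφ1, -, -⟩ := exists_smooth_box_cutoff (n := d)
    (a := fun k => (0 : Fin d → ℝ) k - η) (a' := fun _ => -(η / 2)) (b' := fun _ => 1 + η / 2)
    (b := fun k => (1 : Fin d → ℝ) k + η) (fun k => by simp; linarith) (fun k => by simp; linarith)
  let V : Set (Fin d → ℝ) := Set.pi univ fun _ => Ioo (-(η / 2)) (1 + η / 2)
  have hV : IsOpen V := isOpen_set_pi finite_univ fun _ _ => isOpen_Ioo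
  have hVU : V ⊆ U := fun x hx => hηU
    ⟨fun k => by have := (hx k trivial).1; simp; linarith,
      fun k => by have := (hx k trivial).2; simp; linarith⟩
  have heq : ∀ j, EqOn (fun x => f j x * φ x) (f j) V := fun j x hx => by
    simp [hφ1 x ⟨fun k => (hx k trivial).1.le, fun k => (hx k trivial).2.le⟩]
  refine ⟨V, fun j x => f j x * φ x, hV, fun x hx k _ => ?_, hVU, ⟨fun j => ?_, fun j => ?_⟩, heq⟩
  · have h1 := hx.1 k
    have h2 := hx.2 k
    simp only [Pi.zero_apply, Pi.one_apply] at h1 h2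
    constructor <;> linarith
  · refine contDiff_iff_contDiffAt.2 fun x => ?_
    by_cases hx : x ∈ Icc (fun k => (0 : Fin d → ℝ) k - η) fun k => (1 : Fin d → ℝ) k + η
    · exact (hf.1 j x (hηU hx)).contDiffAt.mul hφ.contDiffAt
    · refine (contDiffAt_const (c := (0 : ℝ))).congr_of_eventuallyEq ?_
      filter_upwards [isClosed_Icc.isOpen_compl.mem_nhds hx] with y hy
      simp [hφ0 y hy]
  · obtain ⟨g, hg, hgf⟩ := hf.2 j
    refine ⟨g, hg, fun x hx i => ?_⟩
    have h1 : (fun x => f j x * φ x) =ᶠ[nhds x] f j :=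
      Filter.eventuallyEq_of_mem (hV.mem_nhds hx) (heq j)
    rw [pderiv', h1.fderiv_eq, hgf x (hVU hx) i]
    congr 2
    funext k
    rcases k with k | k
    · rfl
    · exact (heq _ hx).symm

/-- Markov's inequality for the Jacobian of a map polynomial in a smooth Pfaffian chain. -/
theorem exists_volume_jacobian_le (d r a D : ℕ) : ∃ N : ℝ, 0 ≤ N ∧
    ∀ (V : Set (Fin d → ℝ)) (f : Fin r → (Fin d → ℝ) → ℝ), IsOpen V → IsSmoothChain V r a f →
    Icc (0 : Fin d → ℝ) 1 ⊆ V →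
    ∀ P : Fin d → MvPolynomial (Fin d ⊕ Fin r) ℝ, (∀ i, (P i).totalDegree ≤ D) →
    ∀ δ : Fin d → ℝ, (∀ i, 0 < δ i) → ∀ c : ℝ, 0 < c →
    volume {x ∈ Icc (0 : Fin d → ℝ) 1 | (∀ i, |eval (Sum.elim x fun k => f k x) (P i)| ≤ δ i) ∧
      c ≤ |(Matrix.of fun i j =>
        pderiv' j (fun x => eval (Sum.elim x fun k => f k x) (P i)) x).det|} ≤
      ENNReal.ofReal (N * (∏ i, δ i) / c) := by
  obtain ⟨N, hN⟩ := exists_setLIntegral_chain_jacobian_le r d a D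
  refine ⟨N * 4 ^ d, by positivity, fun V f hV hf hcube P hP δ hδ c hc => ?_⟩
  obtain ⟨φ, hφ, hφ0, hφ1, hφn, hφl⟩ := exists_smooth_box_cutoff (n := d)
    (a := fun k => -(2 * δ k)) (a' := fun k => -δ k) (b' := δ) (b := fun k => 2 * δ k)
    (fun k => by linarith [hδ k]) (fun k => by linarith [hδ k])
  have hsm : ∀ i, ContDiff ℝ ∞ fun x => eval (Sum.elim x fun k => f k x) (P i) := fun i =>
    contDiff_eval_mvPolynomial (F := fun x => Sum.elim x fun k => f k x)
      (Sum.rec (fun k => contDiff_apply ℝ ℝ k) hf.1) (P i)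
  let J : (Fin d → ℝ) → ℝ := fun x => φ (fun i => eval (Sum.elim x fun k => f k x) (P i)) *
    |(Matrix.of fun i j => pderiv' j (fun x => eval (Sum.elim x fun k => f k x) (P i)) x).det|
  have hJ : Continuous J := by
    refine (hφ.continuous.comp (continuous_pi fun i => (hsm i).continuous)).mul
      (Continuous.abs (Continuous.matrix_det (continuous_matrix fun i j => ?_)))
    exact ((hsm i).pderiv' (m := 0) (by simp) j).continuous
  have h_int : ∫⁻ p, ENNReal.ofReal (φ p) ≤ ENNReal.ofReal (4 ^ d * ∏ i, δ i) := by
    calc ∫⁻ p, ENNReal.ofReal (φ p)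
        ≤ ∫⁻ p, (Icc (fun k => -(2 * δ k)) fun k => 2 * δ k).indicator 1 p := by
          refine lintegral_mono fun p => ?_
          by_cases hp : p ∈ Icc (fun k => -(2 * δ k)) fun k => 2 * δ k
          · simpa [indicator_of_mem hp] using hφl p
          · simp [hφ0 p hp]
      _ = ENNReal.ofReal (4 ^ d * ∏ i, δ i) := by
          rw [lintegral_indicator_one measurableSet_Icc, Real.volume_Icc_pi,
            ← ENNReal.ofReal_prod_of_nonneg fun i _ => by linarith [hδ i]]
          congr 1
          rw [← Fin.prod_const, ← Finset.prod_mul_distrib]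
          exact Finset.prod_congr rfl fun i _ => by ring
  have hφc : HasCompactSupport φ := HasCompactSupport.intro isCompact_Icc hφ0
  have hmain := (mul_meas_ge_le_lintegral (μ := volume.restrict (Icc (0 : Fin d → ℝ) 1))
    hJ.measurable.ennreal_ofReal (ENNReal.ofReal c)).trans
      ((hN V f hV hf P hP 0 1 hcube φ (hφ.of_le (by exact_mod_cast le_top)) hφc hφn).trans
        (mul_le_mul_right h_int _))
  rw [Measure.restrict_apply' measurableSet_Icc] at hmain
  have hsub : {x ∈ Icc (0 : Fin d → ℝ) 1 |
      (∀ i, |eval (Sum.elim x fun k => f k x) (P i)| ≤ δ i) ∧ c ≤ |(Matrix.of fun i j =>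
        pderiv' j (fun x => eval (Sum.elim x fun k => f k x) (P i)) x).det|} ⊆
      {x | ENNReal.ofReal c ≤ ENNReal.ofReal (J x)} ∩ Icc 0 1 := by
    rintro x ⟨hx, h1, h2⟩
    refine ⟨ENNReal.ofReal_le_ofReal ?_, hx⟩
    have : φ (fun i => eval (Sum.elim x fun k => f k x) (P i)) = 1 :=
      hφ1 _ ⟨fun i => (abs_le.1 (h1 i)).1, fun i => (abs_le.1 (h1 i)).2⟩
    simpa [J, this] using h2
  refine (measure_mono hsub).trans ?_
  rw [ENNReal.ofReal_div_of_pos hc, ENNReal.le_div_iff_mul_le (by simp [hc]) (by simp), mul_comm,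
    mul_assoc, ENNReal.ofReal_mul (Nat.cast_nonneg _), ENNReal.ofReal_natCast]
  exact hmain

theorem det_eq_det_of_forall_notMem_range {n d : ℕ} {i : Fin n → Fin d}
    (hi : Function.Injective i) (M : Matrix (Fin d) (Fin d) ℝ)
    (hM : ∀ j ∉ range i, M j = Pi.single j 1) :
    M.det = (Matrix.of fun r k => M (i k) (i r)).det := by
  classical
  let e : Fin n ⊕ ((range i)ᶜ : Set (Fin d)) ≃ Fin d :=
    ((Equiv.ofInjective i hi).sumCongr (Equiv.refl _)).trans (Equiv.Set.sumCompl (range i))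
  have h : M.submatrix e e = Matrix.fromBlocks (Matrix.of fun k r => M (i k) (i r))
      (Matrix.of fun k (l : ((range i)ᶜ : Set (Fin d))) => M (i k) l) 0 1 := by
    ext (k | ⟨j, hj⟩) (r | ⟨l, hl⟩)
    · simp [e]
    · simp [e]
    · have : i r ≠ j := fun h => hj ⟨r, h⟩
      simp [e, hM j hj, this]
    · simp [e, hM j hj, Matrix.one_apply, Pi.single_apply, eq_comm]
  rw [← Matrix.det_submatrix_equiv_self e M, h, Matrix.det_fromBlocks_zero₂₁, Matrix.det_one,
    mul_one, ← Matrix.det_transpose]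
  rfl

theorem exists_volume_minor_le {n d : ℕ} (r a D : ℕ) {i : Fin n → Fin d}
    (hi : Function.Injective i) : ∃ N : ℝ, 0 ≤ N ∧
    ∀ (V : Set (Fin d → ℝ)) (f : Fin r → (Fin d → ℝ) → ℝ), IsOpen V → IsSmoothChain V r a f →
    Icc (0 : Fin d → ℝ) 1 ⊆ V →
    ∀ P : Fin n → MvPolynomial (Fin d ⊕ Fin r) ℝ, (∀ k, (P k).totalDegree ≤ D) →
    ∀ δ : Fin n → ℝ, (∀ k, 0 < δ k) → ∀ c : ℝ, 0 < c →
    volume {x ∈ Icc (0 : Fin d → ℝ) 1 | (∀ k, |eval (Sum.elim x fun k => f k x) (P k)| ≤ δ k) ∧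
      c ≤ |(Matrix.of fun l k =>
        pderiv' (i l) (fun x => eval (Sum.elim x fun k => f k x) (P k)) x).det|} ≤
      ENNReal.ofReal (N * (∏ k, δ k) / c) := by
  classical
  obtain ⟨N, hN0, hN⟩ := exists_volume_jacobian_le d r a (max D 1)
  refine ⟨N, hN0, fun V f hV hf hcube P hP δ hδ c hc => ?_⟩
  let Q : Fin d → MvPolynomial (Fin d ⊕ Fin r) ℝ := Function.extend i P fun j => X (Sum.inl j)
  let δ' : Fin d → ℝ := Function.extend i δ 1
  have hQi : ∀ k, Q (i k) = P k := fun k => hi.extend_apply _ _ _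
  have hQr : ∀ j ∉ range i, Q j = X (Sum.inl j) := fun j hj => Function.extend_apply' _ _ _ hj
  have hδi : ∀ k, δ' (i k) = δ k := fun k => hi.extend_apply _ _ _
  have hδr : ∀ j ∉ range i, δ' j = 1 := fun j hj => Function.extend_apply' _ _ _ hj
  have hprod : ∏ j, δ' j = ∏ k, δ k := by
    rw [← Finset.prod_subset (Finset.subset_univ (Finset.univ.image i)) fun j _ hj =>
      hδr j (by simpa using hj), Finset.prod_image hi.injOn]
    exact Finset.prod_congr rfl fun k _ => hδi k
  have := hN V f hV hf hcube Q (fun j => ?_) δ' (fun j => ?_) c hc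
  · rw [hprod] at this
    refine (measure_mono ?_).trans this
    rintro x ⟨hx, h1, h2⟩
    refine ⟨hx, fun j => ?_, ?_⟩
    · by_cases hj : j ∈ range i
      · obtain ⟨k, rfl⟩ := hj
        rw [hQi, hδi]
        exact h1 k
      · rw [hQr j hj, hδr j hj]
        simpa [abs_le] using ⟨(by linarith [show (0 : ℝ) ≤ x j from hx.1 j] : -1 ≤ x j), hx.2 j⟩
    · rw [det_eq_det_of_forall_notMem_range hi]
      · simpa [hQi] using h2
      · intro j hj
        funext l
        simp only [Matrix.of_apply, hQr j hj, eval_X, Sum.elim_inl, pderiv']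
        rw [(hasFDerivAt_apply j x).fderiv]
        simp [Pi.single_apply, eq_comm]
  · by_cases hj : j ∈ range i
    · obtain ⟨k, rfl⟩ := hj
      rw [hQi]
      exact (hP k).trans (le_max_left _ _)
    · rw [hQr j hj]
      exact (totalDegree_X _).le.trans (le_max_right _ _)
  · by_cases hj : j ∈ range i
    · obtain ⟨k, rfl⟩ := hj
      rw [hδi]
      exact hδ k
    · rw [hδr j hj]
      exact one_pos

/-- An admissible operator maps functions that are polynomial in a smooth Pfaffian chain to such
functions, with control of the degree. -/
theorem IsAdmissible.exists_totalDegree_le {d α : ℕ} {β : Fin d → ℕ}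
    {L : ((Fin d → ℝ) → ℝ) → (Fin d → ℝ) → ℝ} (hL : IsAdmissible d α β L) (r a b : ℕ) :
    ∃ D : ℕ, ∀ (V : Set (Fin d → ℝ)) (f : Fin r → (Fin d → ℝ) → ℝ), IsOpen V →
      IsSmoothChain V r a f → ∀ P : MvPolynomial (Fin d ⊕ Fin r) ℝ, P.totalDegree ≤ b →
      ∀ F, EqOn F (fun x => eval (Sum.elim x fun k => f k x) P) V →
      ∃ Q : MvPolynomial (Fin d ⊕ Fin r) ℝ, Q.totalDegree ≤ D ∧
        EqOn (L F) (fun x => eval (Sum.elim x fun k => f k x) Q) V := by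
  induction hL with
  | id => exact ⟨b, fun V f _ _ P hP F hF => ⟨P, hP, hF⟩⟩
  | det n hn hnd i hi αs βs Ls hLs L hL ih =>
    choose D hD using ih
    refine ⟨n * ((∑ k, D k) + a), fun V f hV hf P hP F hF => ?_⟩
    choose Q hQ hQF using fun k => hD k V f hV hf P hP F hF
    obtain ⟨g, hg, hgf⟩ := exists_chain_coefficients hf.2
    refine ⟨(Matrix.of fun l k => chainPderiv g (i l) (Q k)).det,
      totalDegree_det_le _ fun l k => totalDegree_chainPderiv_le hg _ ((hQ k).trans
        (Finset.single_le_sum (f := D) (fun _ _ => Nat.zero_le _) (Finset.mem_univ k))),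
      fun x hx => ?_⟩
    have hFx : ContDiffAt ℝ ∞ F x :=
      (contDiff_eval_mvPolynomial (F := fun x => Sum.elim x fun k => f k x)
        (Sum.rec (fun k => contDiff_apply ℝ ℝ k) hf.1) P).contDiffAt.congr_of_eventuallyEq
        (Filter.eventuallyEq_of_mem (hV.mem_nhds hx) hF)
    rw [hL F x hFx]
    simp only [RingHom.map_det]
    congr 1
    ext l k
    have h1 : Ls k F =ᶠ[nhds x] fun x => eval (Sum.elim x fun k => f k x) (Q k) :=
      Filter.eventuallyEq_of_mem (hV.mem_nhds hx) (hQF k)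
    have h2 := pderiv'_eval_chain (fun k => (hf.1 k).differentiable (by simp) x) (hgf x hx)
      (Q k) (i l)
    simp only [Matrix.of_apply, RingHom.mapMatrix_apply, Matrix.map_apply, ← h2]
    rw [pderiv', h1.fderiv_eq, pderiv']

/-- Sublevel estimate in parametrised form. -/
theorem IsAdmissible.exists_volume_sublevel_le {d α : ℕ} {β : Fin d → ℕ}
    {L : ((Fin d → ℝ) → ℝ) → (Fin d → ℝ) → ℝ} (hL : IsAdmissible d α β L) (r a b : ℕ) :
    ∃ m : ℕ, ∑ i, β i + 1 = α + m ∧ (m = 0 → α = 1 ∧ β = 0) ∧ ∃ C : ℝ, 0 ≤ C ∧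
      ∀ (V : Set (Fin d → ℝ)) (f : Fin r → (Fin d → ℝ) → ℝ), IsOpen V →
      IsSmoothChain V r a f → Icc (0 : Fin d → ℝ) 1 ⊆ V →
      ∀ P : MvPolynomial (Fin d ⊕ Fin r) ℝ, P.totalDegree ≤ b →
      ∀ F, EqOn F (fun x => eval (Sum.elim x fun k => f k x) P) V →
      ∀ ε T : ℝ, 0 < ε → 0 < T →
      volume {x ∈ Icc (0 : Fin d → ℝ) 1 | |F x| ≤ ε ∧ ε ^ α / T ^ m < |L F x|} ≤
        ENNReal.ofReal (C * T) := by
  induction hL with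
  | id =>
    refine ⟨0, by simp, by simp, 0, le_rfl, fun V f _ _ _ P _ F _ ε T _ _ => ?_⟩
    rw [show {x ∈ Icc (0 : Fin d → ℝ) 1 | |F x| ≤ ε ∧ ε ^ 1 / T ^ 0 < |F x|} = ∅ from
      eq_empty_of_forall_notMem fun x hx => by
        have := hx.2.2
        simp only [pow_one, pow_zero, div_one] at this
        exact this.not_ge hx.2.1]
    simp
  | det n hn hnd i hi αs βs Ls hLs L hL ih =>
    choose m hm _ C hC0 hC using ih
    choose D hD using fun k => (hLs k).exists_totalDegree_le r a b
    obtain ⟨N, hN0, hN⟩ := exists_volume_minor_le r a (∑ k, D k) hi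
    refine ⟨∑ k, m k + 1, ?_, by simp, ∑ k, C k + N,
      add_nonneg (Finset.sum_nonneg fun k _ => hC0 k) hN0, ?_⟩
    · have h1 : ∑ k, (∑ i, βs k i + 1) = ∑ k, (αs k + m k) := Finset.sum_congr rfl fun k _ => hm k
      have h2 : ∑ l, ((∑ k, βs k) + ∑ k, (Pi.single (i k) 1 : Fin d → ℕ)) l =
          ∑ k, (∑ l, βs k l + 1) := by
        simp only [Pi.add_apply, Finset.sum_apply, Finset.sum_add_distrib]
        rw [Finset.sum_comm, Finset.sum_comm (f := fun l k => (Pi.single (i k) 1 : Fin d → ℕ) l)]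
        simp
      rw [h2, h1, Finset.sum_add_distrib]
      ring
    · intro V f hV hf hcube P hP F hF ε T hε hT
      choose Q hQ hQF using fun k => hD k V f hV hf P hP F hF
      have hQ' : ∀ k, (Q k).totalDegree ≤ ∑ k, D k := fun k => (hQ k).trans
        (Finset.single_le_sum (f := D) (fun _ _ => Nat.zero_le _) (Finset.mem_univ k))
      have hδ : ∀ k, 0 < ε ^ αs k / T ^ m k := fun k => by positivity
      have hc : 0 < ε ^ (∑ k, αs k) / T ^ (∑ k, m k + 1) := by positivity
      have hE := hN V f hV hf hcube Q hQ' (fun k => ε ^ αs k / T ^ m k) hδ _ hc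
      rw [show N * (∏ k, ε ^ αs k / T ^ m k) / (ε ^ (∑ k, αs k) / T ^ (∑ k, m k + 1)) = N * T by
        rw [Finset.prod_div_distrib, Finset.prod_pow_eq_pow_sum, Finset.prod_pow_eq_pow_sum]
        field_simp
        ring] at hE
      have hsub : {x ∈ Icc (0 : Fin d → ℝ) 1 | |F x| ≤ ε ∧
          ε ^ (∑ k, αs k) / T ^ (∑ k, m k + 1) < |L F x|} ⊆
          (⋃ k, {x ∈ Icc (0 : Fin d → ℝ) 1 | |F x| ≤ ε ∧ ε ^ αs k / T ^ m k < |Ls k F x|}) ∪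
          {x ∈ Icc (0 : Fin d → ℝ) 1 |
            (∀ k, |eval (Sum.elim x fun k => f k x) (Q k)| ≤ ε ^ αs k / T ^ m k) ∧
            ε ^ (∑ k, αs k) / T ^ (∑ k, m k + 1) ≤ |(Matrix.of fun l k => pderiv' (i l)
              (fun x => eval (Sum.elim x fun k => f k x) (Q k)) x).det|} := by
        rintro x ⟨hx, h1, h2⟩
        by_cases h : ∃ k, ε ^ αs k / T ^ m k < |Ls k F x|
        · obtain ⟨k, hk⟩ := h
          exact Or.inl (mem_iUnion.2 ⟨k, hx, h1, hk⟩)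
        · push Not at h
          have hxV := hcube hx
          refine Or.inr ⟨hx, fun k => (congrArg abs (hQF k hxV)).symm.le.trans (h k), ?_⟩
          have hFx : ContDiffAt ℝ ∞ F x :=
            (contDiff_eval_mvPolynomial (F := fun x => Sum.elim x fun k => f k x)
              (Sum.rec (fun k => contDiff_apply ℝ ℝ k) hf.1) P).contDiffAt.congr_of_eventuallyEq
              (Filter.eventuallyEq_of_mem (hV.mem_nhds hxV) hF)
          rw [hL F x hFx] at h2
          refine h2.le.trans (le_of_eq ?_)
          congr 2
          ext l k
          have h3 : Ls k F =ᶠ[nhds x] fun x => eval (Sum.elim x fun k => f k x) (Q k) :=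
            Filter.eventuallyEq_of_mem (hV.mem_nhds hxV) (hQF k)
          simp only [Matrix.of_apply, pderiv', h3.fderiv_eq]
      refine (measure_mono hsub).trans ((measure_union_le _ _).trans ?_)
      rw [add_mul, ENNReal.ofReal_add (mul_nonneg (Finset.sum_nonneg fun k _ => hC0 k) hT.le)
        (mul_nonneg hN0 hT.le)]
      refine add_le_add ((measure_iUnion_fintype_le _ _).trans ?_) hE
      rw [Finset.sum_mul, ENNReal.ofReal_sum_of_nonneg fun k _ => mul_nonneg (hC0 k) hT.le]
      exact Finset.sum_le_sum fun k _ => hC k V f hV hf hcube P hP F hF ε T hε hT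

end Sublevel

/-- Uniform sublevel set estimate for Pfaffian functions: the constant depends only on the
dimension `d`, the admissible operator `L`, and the Pfaffian format `(r, α₀, β₀)`. -/
theorem sublevel_estimate_admissible_pfaffian
    (d : ℕ) (α : ℕ) (β : Fin d → ℕ) (L : ((Fin d → ℝ) → ℝ) → (Fin d → ℝ) → ℝ)
    (hL : IsAdmissible d α β L) (hne : ¬(α = 1 ∧ β = 0))
    (r α₀ β₀ : ℕ) (hα₀ : 1 ≤ α₀) (hβ₀ : 1 ≤ β₀) :
    ∃ C : ℝ, ∀ U : Set (Fin d → ℝ), IsOpen U → IsConnected U →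
      Set.Icc (0 : Fin d → ℝ) 1 ⊆ U →
      ∀ F : (Fin d → ℝ) → ℝ, IsPfaffianFn U r α₀ β₀ F →
      ∀ D : Set (Fin d → ℝ), IsClosed D → D ⊆ Set.Icc (0 : Fin d → ℝ) 1 →
      ∀ c : ℝ, 0 < c → (∀ x ∈ D, c ≤ |L F x|) → ∀ ε : ℝ, 0 < ε →
        volume {x ∈ D | |F x| ≤ ε} ≤
          ENNReal.ofReal
            (C * ε ^ ((α : ℝ) / (((∑ i, β i : ℕ) : ℝ) + 1 - (α : ℝ))) *
              c ^ (-(1 : ℝ) / (((∑ i, β i : ℕ) : ℝ) + 1 - (α : ℝ)))) := by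
  obtain ⟨m, hm, hm0, C, hC0, hC⟩ := hL.exists_volume_sublevel_le r α₀ β₀
  have hmne : m ≠ 0 := fun h => hne (hm0 h)
  have hm' : (m : ℝ) ≠ 0 := Nat.cast_ne_zero.2 hmne
  refine ⟨C * 2 ^ (1 / (m : ℝ)), ?_⟩
  rintro U hU - hcube F ⟨f, hf, P, hP, hF⟩ D - hD c hc hLF ε hε
  obtain ⟨V, g, hV, hcubeV, hVU, hg, hgf⟩ := hf.exists_isSmoothChain hU hcube
  have hFV : Set.EqOn F (fun x => MvPolynomial.eval (Sum.elim x fun k => g k x) P) V := by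
    intro x hx
    simp only [hgf _ hx]
    exact hF x (hVU hx)
  let T : ℝ := (2 * ε ^ α / c) ^ (1 / (m : ℝ))
  have hT : 0 < T := by positivity
  have hTm : T ^ m = 2 * ε ^ α / c := by
    rw [← Real.rpow_natCast, ← Real.rpow_mul (by positivity), one_div, inv_mul_cancel₀ hm',
      Real.rpow_one]
  have hexp : (((∑ i, β i : ℕ) : ℝ) + 1 - (α : ℝ)) = m := by
    have : ((∑ i, β i : ℕ) : ℝ) + 1 = α + m := by exact_mod_cast hm
    linarith
  have hTeq : C * 2 ^ (1 / (m : ℝ)) * ε ^ ((α : ℝ) / m) * c ^ (-(1 : ℝ) / m) = C * T := by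
    simp only [T]
    rw [Real.div_rpow (by positivity) hc.le, Real.mul_rpow (by norm_num) (by positivity),
      ← Real.rpow_natCast, ← Real.rpow_mul hε.le, neg_div, Real.rpow_neg hc.le, mul_one_div]
    ring
  rw [hexp, hTeq]
  refine (measure_mono ?_).trans (hC V g hV hg hcubeV P hP F hFV ε T hε hT)
  rintro x ⟨hx, hxε⟩
  refine ⟨hD hx, hxε, lt_of_lt_of_le ?_ (hLF x hx)⟩
  rw [hTm, div_lt_iff₀ (by positivity), mul_div_cancel₀ _ hc.ne']
  linarith [pow_pos hε α]
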